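/- arXiv:math/9410223 — 6 statements merged into one kernel-verified Lean document; each statement's English description precedes it below -/
import Mathlib

section
/- Let f ∈ PL([0,1]), let p ≥ 1, and let T ⊆ [0,1] be an interval such that f^i restricted to T is injective for each 0 ≤ i ≤ p−1. Suppose the collection {T, f(T), …, f^{p−1}(T)} has intersection multiplicity at most w, i.e., every point of [0,1] lies in at most w of these intervals. Then the total variation of log|Df^p| over T is at most w·V, where V = Var(log|Df|). -/
/-- `f` is a piecewise affine map of `[0,1]` into itself: continuous, and affine with
nonzero slope on each interval of some finite partition `0 = a 0 < a 1 < ⋯ < a d = 1`. -/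
def IsPLMap (f : ℝ → ℝ) : Prop :=
  ContinuousOn f (Set.Icc 0 1) ∧ Set.MapsTo f (Set.Icc 0 1) (Set.Icc 0 1) ∧
    ∃ (d : ℕ) (a s c : ℕ → ℝ), 1 ≤ d ∧ a 0 = 0 ∧ a d = 1 ∧
      (∀ i < d, a i < a (i + 1)) ∧ (∀ i < d, s i ≠ 0) ∧
      (∀ i < d, ∀ x ∈ Set.Icc (a i) (a (i + 1)), f x = s i * x + c i)

/-- The set of corner points of `f`: interior points of `[0,1]` where the two
one-sided derivatives (slopes) of `f` differ. -/
def cornerSet (f : ℝ → ℝ) : Set ℝ :=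
  {x | x ∈ Set.Ioo (0 : ℝ) 1 ∧
    derivWithin f (Set.Ici x) x ≠ derivWithin f (Set.Iic x) x}

/-- `V = Var(log |Df|)`, the total variation of `log |Df|` over `[0,1]`, i.e. the sum
over the corner points of `f` of the jumps of `log |Df|` there. -/
noncomputable def logSlopeVar (f : ℝ → ℝ) : ℝ :=
  ∑ᶠ x ∈ cornerSet f,
    |Real.log (|derivWithin f (Set.Ici x) x|) - Real.log (|derivWithin f (Set.Iic x) x|)|

/-- `I 0, …, I (q-1)` is a cycle of `f`: pairwise disjoint nondegenerate closed
subintervals of `[0,1]` mapped cyclically into one another by `f`. -/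
def IsCycle (f : ℝ → ℝ) (q : ℕ) (I : ℕ → Set ℝ) : Prop :=
  1 ≤ q ∧ (∀ j < q, ∃ u v : ℝ, u < v ∧ I j = Set.Icc u v) ∧
    (∀ j < q, I j ⊆ Set.Icc 0 1) ∧
    (∀ i < q, ∀ j < q, i ≠ j → Disjoint (I i) (I j)) ∧
    (∀ j < q, f '' I j ⊆ I ((j + 1) % q))

/-- The union `∪𝓘` of the intervals of a cycle. -/
def cycleUnion (q : ℕ) (I : ℕ → Set ℝ) : Set ℝ := ⋃ j < q, I j

/-- `𝓘¹ ⊃ 𝓘²`, the cycles are nested: every interval of the cycle `𝓘²` is contained in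
some interval of the cycle `𝓘¹`, and the two collections of intervals are different. -/
def CycleNested (q₁ : ℕ) (I1 : ℕ → Set ℝ) (q₂ : ℕ) (I2 : ℕ → Set ℝ) : Prop :=
  (∀ j < q₂, ∃ i < q₁, I2 j ⊆ I1 i) ∧ I2 '' Set.Iio q₂ ≠ I1 '' Set.Iio q₁

/-- `G` is a gap of the cycle `I2`, with left neighbour `I2 l` and right neighbour
`I2 r`: an open interval disjoint from `∪𝓘²` lying strictly between the two adjacent
intervals `I2 l` and `I2 r` (whose closures it meets). -/
def IsGap (q₂ : ℕ) (I2 : ℕ → Set ℝ) (l r : ℕ) (G : Set ℝ) : Prop :=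
  l < q₂ ∧ r < q₂ ∧
    ∃ a b : ℝ, a < b ∧ G = Set.Ioo a b ∧
      a ∈ I2 l ∧ (∀ y ∈ I2 l, y ≤ a) ∧ b ∈ I2 r ∧ (∀ y ∈ I2 r, b ≤ y) ∧
      ∀ j < q₂, Disjoint G (I2 j)

/-- `P` is a splitting for the nested pair of cycles `𝓘¹ ⊃ 𝓘²`: a finite union of
periodic orbits of `f` such that every point of `P` lies in a gap and every gap
contains exactly one point of `P`. -/
def IsSplitting (f : ℝ → ℝ) (q₁ : ℕ) (I1 : ℕ → Set ℝ) (q₂ : ℕ) (I2 : ℕ → Set ℝ)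
    (P : Set ℝ) : Prop :=
  P.Finite ∧ Set.MapsTo f P P ∧ (∀ x ∈ P, ∃ p, 1 ≤ p ∧ f^[p] x = x) ∧
    (∀ x ∈ P, ∃ i < q₁, ∃ l r G, IsGap q₂ I2 l r G ∧ G ⊆ I1 i ∧ x ∈ G) ∧
    (∀ i < q₁, ∀ l r G, IsGap q₂ I2 l r G → G ⊆ I1 i → ∃! x, x ∈ P ∩ G)

/-- The cycle `I2` (with `q₂` intervals) is a doubling of the cycle `I` (with `q`
intervals): `I` is a cycle, `𝓘 ⊃ 𝓘²`, and `q₂ = 2q`. -/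
def IsDoublingOf (f : ℝ → ℝ) (q₂ : ℕ) (I2 : ℕ → Set ℝ) (q : ℕ) (I : ℕ → Set ℝ) : Prop :=
  IsCycle f q I ∧ CycleNested q I q₂ I2 ∧ q₂ = 2 * q

/-- `x` is a periodic point of `f` of minimal period `p`. -/
def MinimalPeriod (f : ℝ → ℝ) (x : ℝ) (p : ℕ) : Prop :=
  1 ≤ p ∧ f^[p] x = x ∧ ∀ k, 1 ≤ k → k < p → f^[k] x ≠ x

open Set

lemma add_mul_mem_Icc {x e t r : ℝ} (hx : x ∈ Icc (0 : ℝ) 1) (hxr : x + e * r ∈ Icc (0 : ℝ) 1)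
    (ht : 0 ≤ t) (htr : t ≤ r) : x + e * t ∈ Icc (0 : ℝ) 1 := by
  obtain ⟨hx0, hx1⟩ := hx
  obtain ⟨hr0, hr1⟩ := hxr
  rcases le_total 0 e with he | he
  · have h1 := mul_nonneg he ht
    have h2 := mul_le_mul_of_nonneg_left htr he
    constructor <;> linarith
  · have h1 := mul_nonpos_of_nonpos_of_nonneg he ht
    have h2 := mul_le_mul_of_nonpos_left htr he
    constructor <;> linarith

/-- `a` is a partition of `[0,1]` into `d` pieces, and `f` is `x ↦ s i * x + c i`, with
`s i ≠ 0`, on the `i`-th piece. -/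
structure IsAffinePartition (f : ℝ → ℝ) (d : ℕ) (a s c : ℕ → ℝ) : Prop where
  zero : a 0 = 0
  last : a d = 1
  lt_succ : ∀ i < d, a i < a (i + 1)
  slope_ne : ∀ i < d, s i ≠ 0
  eq_affine : ∀ i < d, ∀ x ∈ Icc (a i) (a (i + 1)), f x = s i * x + c i

namespace IsAffinePartition

variable {f : ℝ → ℝ} {d : ℕ} {a s c : ℕ → ℝ}

lemma lt (h : IsAffinePartition f d a s c) {i j : ℕ} (hij : i < j) (hj : j ≤ d) :
    a i < a j := by
  induction j, hij using Nat.le_induction with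
  | base => exact h.lt_succ i hj
  | succ n _ ih => exact (ih (by omega)).trans (h.lt_succ n hj)

lemma le (h : IsAffinePartition f d a s c) {i j : ℕ} (hij : i ≤ j) (hj : j ≤ d) :
    a i ≤ a j := by
  rcases hij.eq_or_lt with rfl | hlt
  · exact le_rfl
  · exact (h.lt hlt hj).le

lemma exists_mem_Ico (h : IsAffinePartition f d a s c) {u : ℝ} (hu : u ∈ Ico (0 : ℝ) 1) :
    ∃ i < d, u ∈ Ico (a i) (a (i + 1)) := by
  have key : ∀ n, u < a n → ∃ i < n, u ∈ Ico (a i) (a (i + 1)) := by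
    intro n
    induction n with
    | zero => intro hn; rw [h.zero] at hn; exact absurd hu.1 hn.not_ge
    | succ n ih =>
      intro hn
      rcases lt_or_ge u (a n) with hlt | hge
      · obtain ⟨i, hi, hi'⟩ := ih hlt
        exact ⟨i, by omega, hi'⟩
      · exact ⟨n, by omega, hge, hn⟩
  exact key d (h.last ▸ hu.2)

lemma exists_mem_Ioc (h : IsAffinePartition f d a s c) {u : ℝ} (hu : u ∈ Ioc (0 : ℝ) 1) :
    ∃ i < d, u ∈ Ioc (a i) (a (i + 1)) := by
  have key : ∀ n, u ≤ a n → ∃ i < n, u ∈ Ioc (a i) (a (i + 1)) := by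
    intro n
    induction n with
    | zero => intro hn; rw [h.zero] at hn; exact absurd hu.1 hn.not_gt
    | succ n ih =>
      intro hn
      rcases le_or_gt u (a n) with hle | hgt
      · obtain ⟨i, hi, hi'⟩ := ih hle
        exact ⟨i, by omega, hi'⟩
      · exact ⟨n, by omega, hgt, hn⟩
  exact key d (h.last ▸ hu.2)

/-- A short enough segment issuing from a point of `[0,1]` stays in one piece. -/
lemma exists_segment_mem_piece (h : IsAffinePartition f d a s c) {u v ε : ℝ} (hv : v ≠ 0)
    (hε : 0 < ε) (hu : u ∈ Icc (0 : ℝ) 1) (huv : u + v * ε ∈ Icc (0 : ℝ) 1) :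
    ∃ δ, 0 < δ ∧ δ ≤ ε ∧ ∃ i < d, u ∈ Icc (a i) (a (i + 1)) ∧
      ∀ t ∈ Ioc 0 δ, u + v * t ∈ Ioo (a i) (a (i + 1)) := by
  rcases hv.lt_or_gt with hneg | hpos
  · have hu0 : 0 < u := by nlinarith [huv.1, mul_pos (neg_pos.2 hneg) hε]
    obtain ⟨i, hi, hl, hr⟩ := h.exists_mem_Ioc ⟨hu0, hu.2⟩
    have hδ : 0 < (u - a i) / (2 * -v) := div_pos (by linarith) (by linarith)
    refine ⟨min ε ((u - a i) / (2 * -v)), lt_min hε hδ, min_le_left _ _, i, hi,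
      ⟨hl.le, hr⟩, fun t ht => ?_⟩
    have h1 := (le_div_iff₀ (by linarith)).1 (ht.2.trans (min_le_right _ _))
    have h2 := mul_pos (neg_pos.2 hneg) ht.1
    constructor <;> nlinarith
  · have hu1 : u < 1 := by nlinarith [huv.2, mul_pos hpos hε]
    obtain ⟨i, hi, hl, hr⟩ := h.exists_mem_Ico ⟨hu.1, hu1⟩
    have hδ : 0 < (a (i + 1) - u) / (2 * v) := div_pos (by linarith) (by linarith)
    refine ⟨min ε ((a (i + 1) - u) / (2 * v)), lt_min hε hδ, min_le_left _ _, i, hi,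
      ⟨hl, hr.le⟩, fun t ht => ?_⟩
    have h1 := (le_div_iff₀ (by linarith)).1 (ht.2.trans (min_le_right _ _))
    have h2 := mul_pos hpos ht.1
    constructor <;> nlinarith

/-- On a short enough segment issuing from a point of `[0,1]`, the iterate `f^k` is affine,
and its slope is the product of the slopes of the pieces visited. -/
lemma exists_iterate_affine (h : IsAffinePartition f d a s c)
    (hmaps : MapsTo f (Icc 0 1) (Icc 0 1)) {x e ε₀ : ℝ} (he : e ≠ 0) (hε₀ : 0 < ε₀)
    (hx : x ∈ Icc (0 : ℝ) 1) (hxe : x + e * ε₀ ∈ Icc (0 : ℝ) 1) (k : ℕ) :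
    ∃ ε, 0 < ε ∧ ε ≤ ε₀ ∧ ∃ ι : ℕ → ℕ,
      (∀ j < k, ι j < d ∧
        ∀ t ∈ Ioc 0 ε, f^[j] (x + e * t) ∈ Ioo (a (ι j)) (a (ι j + 1))) ∧
      ∀ t ∈ Icc 0 ε, f^[k] (x + e * t) = f^[k] x + (∏ j ∈ Finset.range k, s (ι j)) * e * t := by
  induction k with
  | zero => exact ⟨ε₀, hε₀, le_rfl, fun _ => 0, by simp, by simp⟩
  | succ k ih =>
    obtain ⟨ε, hε, hεε₀, ι, hι, haff⟩ := ih
    have hσ : (∏ j ∈ Finset.range k, s (ι j)) * e ≠ 0 :=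
      mul_ne_zero (Finset.prod_ne_zero_iff.2 fun j hj =>
        h.slope_ne _ (hι j (Finset.mem_range.1 hj)).1) he
    have hend := hmaps.iterate k (add_mul_mem_Icc hx hxe hε.le hεε₀)
    rw [haff ε ⟨hε.le, le_rfl⟩] at hend
    obtain ⟨δ, hδ, hδε, i, hi, hui, hpiece⟩ :=
      h.exists_segment_mem_piece hσ hε (hmaps.iterate k hx) hend
    refine ⟨δ, hδ, hδε.trans hεε₀, Function.update ι k i, fun j hj => ?_, fun t ht => ?_⟩
    · rcases (Nat.lt_succ_iff.1 hj).eq_or_lt with rfl | hjk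
      · simp only [Function.update_self]
        refine ⟨hi, fun t ht => ?_⟩
        rw [haff t ⟨ht.1.le, ht.2.trans hδε⟩]
        exact hpiece t ht
      · rw [Function.update_of_ne hjk.ne]
        exact ⟨(hι j hjk).1, fun t ht => (hι j hjk).2 t ⟨ht.1, ht.2.trans hδε⟩⟩
    · have hprod : ∏ j ∈ Finset.range k, s (Function.update ι k i j) =
          ∏ j ∈ Finset.range k, s (ι j) :=
        Finset.prod_congr rfl fun j hj => by
          rw [Function.update_of_ne (Finset.mem_range.1 hj).ne]
      have hmem : f^[k] (x + e * t) ∈ Icc (a i) (a (i + 1)) := by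
        rw [haff t ⟨ht.1, ht.2.trans hδε⟩]
        rcases ht.1.eq_or_lt with rfl | ht0
        · simpa using hui
        · exact Ioo_subset_Icc_self (hpiece t ⟨ht0, ht.2⟩)
      rw [Finset.prod_range_succ, hprod, Function.update_self, Function.iterate_succ_apply',
        Function.iterate_succ_apply', h.eq_affine i hi _ hmem, h.eq_affine i hi _ hui,
        haff t ⟨ht.1, ht.2.trans hδε⟩]
      ring

/-- The jump of `log |Df|` at the `m`-th partition point. -/
noncomputable def jump (s : ℕ → ℝ) (m : ℕ) : ℝ := |Real.log (|s m|) - Real.log (|s (m - 1)|)|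

lemma abs_log_slope_sub_le (s : ℕ → ℝ) {i j : ℕ} (hij : i ≤ j) :
    |Real.log (|s j|) - Real.log (|s i|)| ≤ ∑ m ∈ Finset.Ioc i j, jump s m := by
  induction j, hij using Nat.le_induction with
  | base => simp
  | succ n hn ih =>
    rw [← Finset.insert_Ioc_right_eq_Ioc_add_one hn, Finset.sum_insert (by simp)]
    have := abs_sub_le (Real.log |s (n + 1)|) (Real.log |s n|) (Real.log |s i|)
    simp only [jump, Nat.add_sub_cancel] at *
    linarith

lemma derivWithin_Ici (h : IsAffinePartition f d a s c) {i : ℕ} (hi : i < d) {x : ℝ}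
    (hx : x ∈ Ico (a i) (a (i + 1))) : derivWithin f (Ici x) x = s i := by
  have hd : HasDerivWithinAt (fun y => s i * y + c i) (s i) (Ici x) x := by
    simpa using (((hasDerivAt_id x).const_mul (s i)).add_const (c i)).hasDerivWithinAt
  refine (hd.congr_of_eventuallyEq ?_ (h.eq_affine i hi x ⟨hx.1, hx.2.le⟩)).derivWithin
    (uniqueDiffWithinAt_Ici x)
  filter_upwards [Ico_mem_nhdsGE hx.2] with y hy
  exact h.eq_affine i hi y ⟨hx.1.trans hy.1, hy.2.le⟩

lemma derivWithin_Iic (h : IsAffinePartition f d a s c) {i : ℕ} (hi : i < d) {x : ℝ}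
    (hx : x ∈ Ioc (a i) (a (i + 1))) : derivWithin f (Iic x) x = s i := by
  have hd : HasDerivWithinAt (fun y => s i * y + c i) (s i) (Iic x) x := by
    simpa using (((hasDerivAt_id x).const_mul (s i)).add_const (c i)).hasDerivWithinAt
  refine (hd.congr_of_eventuallyEq ?_ (h.eq_affine i hi x ⟨hx.1.le, hx.2⟩)).derivWithin
    (uniqueDiffWithinAt_Iic x)
  filter_upwards [Ioc_mem_nhdsLE hx.1] with y hy
  exact h.eq_affine i hi y ⟨hy.1.le, hy.2.trans hx.2⟩

lemma logSlopeVar_eq_sum_jump (h : IsAffinePartition f d a s c) :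
    logSlopeVar f = ∑ m ∈ Finset.Ioo 0 d, jump s m := by
  have hr : ∀ m ∈ Finset.Ioo 0 d, derivWithin f (Ici (a m)) (a m) = s m := fun m hm => by
    rw [Finset.mem_Ioo] at hm
    exact h.derivWithin_Ici hm.2 ⟨le_rfl, h.lt_succ m hm.2⟩
  have hl : ∀ m ∈ Finset.Ioo 0 d, derivWithin f (Iic (a m)) (a m) = s (m - 1) := fun m hm => by
    rw [Finset.mem_Ioo] at hm
    have e : m - 1 + 1 = m := by omega
    exact h.derivWithin_Iic (by omega) ⟨h.lt (by omega) (by omega), by rw [e]⟩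
  have hinj : InjOn a (Finset.Ioo 0 d) := by
    intro i hi j hj hij
    simp only [Finset.coe_Ioo, mem_Ioo] at hi hj
    rcases lt_trichotomy i j with hlt | rfl | hlt
    · exact absurd hij (h.lt hlt hj.2.le).ne
    · rfl
    · exact absurd hij (h.lt hlt hi.2.le).ne'
  classical
  unfold logSlopeVar
  rw [finsum_mem_eq_sum_of_inter_support_eq _ (t := (Finset.Ioo 0 d).image a)]
  · rw [Finset.sum_image hinj]
    exact Finset.sum_congr rfl fun m hm => by rw [hr m hm, hl m hm, jump]
  · ext x
    simp only [mem_inter_iff, Finset.coe_image, and_congr_left_iff]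
    intro hx
    constructor
    · rintro ⟨hx01, hne⟩
      obtain ⟨i, hi, hi'⟩ := h.exists_mem_Ico ⟨hx01.1.le, hx01.2⟩
      rcases hi'.1.eq_or_lt with rfl | hlt
      · refine ⟨i, ?_, rfl⟩
        have : i ≠ 0 := by rintro rfl; rw [h.zero] at hx01; exact lt_irrefl _ hx01.1
        simp only [Finset.coe_Ioo, mem_Ioo]
        omega
      · exact absurd ((h.derivWithin_Ici hi hi').trans
          (h.derivWithin_Iic hi ⟨hlt, hi'.2.le⟩).symm) hne
    · rintro ⟨m, hm, rfl⟩
      have hm' : 0 < m ∧ m < d := by simpa using hm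
      refine ⟨⟨h.zero ▸ h.lt hm'.1 hm'.2.le, h.last ▸ h.lt hm'.2 le_rfl⟩, fun heq => hx ?_⟩
      simp [heq]

/-- If `f^p` is differentiable at `x` relative to `[0,1]`, its derivative is the product of the
slopes of the pieces visited by points arbitrarily close to `x`, on either side of `x`. -/
lemma exists_itinerary (h : IsAffinePartition f d a s c)
    (hmaps : MapsTo f (Icc 0 1) (Icc 0 1)) {x e : ℝ} (he : e ≠ 0)
    (hx : x ∈ Icc (0 : ℝ) 1) (hxe : x + e * (1 / 3) ∈ Icc (0 : ℝ) 1) (p : ℕ)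
    (hdiff : DifferentiableWithinAt ℝ (f^[p]) (Icc 0 1) x) :
    ∃ t ∈ Ioc (0 : ℝ) (1 / 3), ∃ ι : ℕ → ℕ,
      (∀ j < p, ι j < d ∧ f^[j] (x + e * t) ∈ Ioo (a (ι j)) (a (ι j + 1))) ∧
      Real.log |derivWithin (f^[p]) (Icc 0 1) x| =
        ∑ j ∈ Finset.range p, Real.log |s (ι j)| := by
  obtain ⟨ε, hε, hε3, ι, hι, haff⟩ :=
    h.exists_iterate_affine hmaps he (by norm_num) hx hxe p
  refine ⟨ε, ⟨hε, hε3⟩, ι, fun j hj => ⟨(hι j hj).1, (hι j hj).2 ε ⟨hε, le_rfl⟩⟩, ?_⟩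
  have hmapsTo : MapsTo (fun t => x + e * t) (Icc 0 ε) (Icc 0 1) :=
    fun t ht => add_mul_mem_Icc hx hxe ht.1 (ht.2.trans hε3)
  have hline : HasDerivWithinAt (fun t : ℝ => x + e * t) e (Icc 0 ε) 0 := by
    simpa using (((hasDerivAt_id (0 : ℝ)).const_mul e).const_add x).hasDerivWithinAt
  have hcomp : HasDerivWithinAt (f^[p] ∘ fun t => x + e * t)
      (derivWithin (f^[p]) (Icc 0 1) x * e) (Icc 0 ε) 0 := by
    refine HasDerivWithinAt.comp (0 : ℝ) ?_ hline hmapsTo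
    simpa using hdiff.hasDerivWithinAt
  have haff' : HasDerivWithinAt (f^[p] ∘ fun t => x + e * t)
      ((∏ j ∈ Finset.range p, s (ι j)) * e) (Icc 0 ε) 0 := by
    have : HasDerivWithinAt (fun t => f^[p] x + (∏ j ∈ Finset.range p, s (ι j)) * e * t)
        ((∏ j ∈ Finset.range p, s (ι j)) * e) (Icc 0 ε) 0 := by
      simpa using (((hasDerivAt_id (0 : ℝ)).const_mul
        ((∏ j ∈ Finset.range p, s (ι j)) * e)).const_add (f^[p] x)).hasDerivWithinAt
    exact this.congr haff (haff 0 ⟨le_rfl, hε.le⟩)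
  have hu : UniqueDiffWithinAt ℝ (Icc 0 ε) 0 := uniqueDiffOn_Icc hε 0 ⟨le_rfl, hε.le⟩
  have heq := mul_right_cancel₀ he (hu.eq_deriv _ hcomp haff')
  rw [heq, Finset.abs_prod, Real.log_prod]
  intro j hj
  exact abs_ne_zero.2 (h.slope_ne _ (hι j (Finset.mem_range.1 hj)).1)

/-- The variation of `log |Df|` between two points of the interiors of pieces is at most the
sum of the jumps at the partition points between them. -/
lemma abs_log_slope_sub_le_sum_between (h : IsAffinePartition f d a s c) {i j : ℕ}
    (hi : i < d) (hj : j < d) {u v : ℝ} (hu : u ∈ Ioo (a i) (a (i + 1)))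
    (hv : v ∈ Ioo (a j) (a (j + 1))) (P : ℕ → Prop) [DecidablePred P]
    (hP : ∀ m, a m ∈ uIcc u v → P m) :
    |Real.log (|s j|) - Real.log (|s i|)| ≤
      ∑ m ∈ Finset.Ioo 0 d, if P m then jump s m else 0 := by
  wlog hij : i ≤ j generalizing i j u v
  · rw [abs_sub_comm]
    exact this hj hi hv hu (fun m hm => hP m (uIcc_comm v u ▸ hm)) (by omega)
  refine (abs_log_slope_sub_le s hij).trans ?_
  rw [← Finset.sum_filter]
  refine Finset.sum_le_sum_of_subset_of_nonneg (fun m hm => ?_) fun _ _ _ => abs_nonneg _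
  rw [Finset.mem_Ioc] at hm
  rw [Finset.mem_filter, Finset.mem_Ioo]
  refine ⟨by omega, hP m ?_⟩
  exact Icc_subset_uIcc ⟨hu.2.le.trans (h.le hm.1 (by omega)), (h.le hm.2 hj.le).trans hv.1.le⟩

end IsAffinePartition

/-- A function whose increments are dominated by those of `φ` has variation at most the
oscillation of `φ`. -/
lemma eVariationOn_le_of_abs_sub_le {g φ : ℝ → ℝ} {S : Set ℝ} {M : ℝ}
    (hφ : ∀ x ∈ S, φ x ∈ Icc 0 M)
    (hg : ∀ x ∈ S, ∀ y ∈ S, x < y → |g y - g x| ≤ φ y - φ x) :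
    eVariationOn g S ≤ ENNReal.ofReal M := by
  refine iSup_le fun ⟨n, u, hu, huS⟩ => ?_
  have hstep : ∀ i, |g (u (i + 1)) - g (u i)| ≤ φ (u (i + 1)) - φ (u i) := fun i => by
    rcases (hu (Nat.le_succ i)).eq_or_lt with heq | hlt
    · simp only [Nat.succ_eq_add_one] at heq
      simp [heq]
    · exact hg _ (huS i) _ (huS (i + 1)) hlt
  simp only [edist_dist, Real.dist_eq]
  rw [← ENNReal.ofReal_sum_of_nonneg fun _ _ => abs_nonneg _]
  refine ENNReal.ofReal_le_ofReal ((Finset.sum_le_sum fun i _ => hstep i).trans ?_)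
  rw [Finset.sum_range_sub (fun i => φ (u i))]
  linarith [(hφ _ (huS n)).2, (hφ _ (huS 0)).1]

/-- If `f ∈ PL([0,1])`, `T ⊆ [0,1]` is an interval on which each `f^i` (`i < p`) is
injective, and the collection `T, f(T), …, f^(p-1)(T)` has intersection multiplicity at
most `w`, then the total variation of `log |Df^p|` over `T` is at most `w·V`. -/
theorem variation_of_iterate_le (f : ℝ → ℝ) (hf : IsPLMap f)
    (p w : ℕ) (hp : 1 ≤ p)
    (T : Set ℝ) (hT : T ⊆ Set.Icc 0 1) (hTconn : T.OrdConnected)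
    (hinj : ∀ i < p, Set.InjOn (f^[i]) T)
    (hmult : ∀ y : ℝ, Set.ncard {k | k < p ∧ y ∈ f^[k] '' T} ≤ w) :
    eVariationOn (fun y => Real.log (|derivWithin (f^[p]) (Set.Icc 0 1) y|))
        (T ∩ {y | DifferentiableWithinAt ℝ (f^[p]) (Set.Icc 0 1) y})
      ≤ ENNReal.ofReal (w * logSlopeVar f) := by
  classical
  obtain ⟨hcont, hmaps, d, a, s, c, -, h0, h1, hlt, hne, heq⟩ := hf
  have h : IsAffinePartition f d a s c := ⟨h0, h1, hlt, hne, heq⟩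
  have hnonneg : ∀ m, 0 ≤ IsAffinePartition.jump s m := fun m => abs_nonneg _
  have hcontk : ∀ k, ContinuousOn (f^[k]) (Icc 0 1) := fun k => hcont.iterate hmaps k
  let φ : ℝ → ℝ := fun x => ∑ k ∈ Finset.range p, ∑ m ∈ Finset.Ioo 0 d,
    if ∃ z ∈ T, z < x ∧ f^[k] z = a m then IsAffinePartition.jump s m else 0
  rw [h.logSlopeVar_eq_sum_jump]
  refine eVariationOn_le_of_abs_sub_le (φ := φ) (fun x _ => ⟨?_, ?_⟩) ?_
  · refine Finset.sum_nonneg fun k _ => Finset.sum_nonneg fun m _ => ?_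
    split_ifs
    exacts [hnonneg m, le_rfl]
  · rw [Finset.mul_sum]
    simp only [φ]
    rw [Finset.sum_comm]
    refine Finset.sum_le_sum fun m _ => ?_
    rw [← Finset.sum_filter, Finset.sum_const, nsmul_eq_mul]
    refine mul_le_mul_of_nonneg_right ?_ (hnonneg m)
    refine Nat.cast_le.2 (le_trans ?_ (hmult (a m)))
    rw [← Set.ncard_coe_finset]
    refine Set.ncard_le_ncard ?_ ((Set.finite_lt_nat p).subset fun k hk => hk.1)
    intro k hk
    simp only [Finset.coe_filter, Finset.mem_range, mem_ofPred_eq] at hk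
    obtain ⟨hk, z, hz, -, hzk⟩ := hk
    exact ⟨hk, z, hz, hzk⟩
  · rintro x ⟨hxT, hxd⟩ y ⟨hyT, hyd⟩ hxy
    have hx := hT hxT
    have hy := hT hyT
    obtain ⟨t, ht, ι, hι, hιx⟩ := h.exists_itinerary hmaps (e := y - x) (by linarith) hx
      ⟨by linarith [hx.1], by linarith [hy.2]⟩ p hxd
    obtain ⟨r, hr, κ, hκ, hκy⟩ := h.exists_itinerary hmaps (e := x - y) (by linarith) hy
      ⟨by linarith [hx.1], by linarith [hy.2]⟩ p hyd
    have hx'1 : x < x + (y - x) * t := by nlinarith [ht.1]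
    have hy'1 : y + (x - y) * r < y := by nlinarith [hr.1]
    have hx'y' : x + (y - x) * t ≤ y + (x - y) * r := by nlinarith [ht.2, hr.2]
    rw [hιx, hκy, ← Finset.sum_sub_distrib]
    refine (Finset.abs_sum_le_sum_abs _ _).trans ?_
    simp only [φ]
    rw [← Finset.sum_sub_distrib]
    refine Finset.sum_le_sum fun k hk => ?_
    rw [Finset.mem_range] at hk
    refine (h.abs_log_slope_sub_le_sum_between (hι k hk).1 (hκ k hk).1 (hι k hk).2 (hκ k hk).2
      (fun m => ∃ z ∈ T, x ≤ z ∧ z < y ∧ f^[k] z = a m) fun m hm => ?_).trans ?_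
    · have hsub : uIcc (x + (y - x) * t) (y + (x - y) * r) ⊆ Icc 0 1 := by
        rw [uIcc_of_le hx'y']
        exact Icc_subset_Icc (hx.1.trans hx'1.le) (hy'1.le.trans hy.2)
      obtain ⟨z, hz, hzm⟩ := intermediate_value_uIcc ((hcontk k).mono hsub) hm
      rw [uIcc_of_le hx'y'] at hz
      have hxz : x ≤ z := hx'1.le.trans hz.1
      have hzy : z < y := hz.2.trans_lt hy'1
      exact ⟨z, hTconn.out hxT hyT ⟨hxz, hzy.le⟩, hxz, hzy, hzm⟩
    · rw [← Finset.sum_sub_distrib]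
      refine Finset.sum_le_sum fun m _ => ?_
      by_cases hin : ∃ z ∈ T, x ≤ z ∧ z < y ∧ f^[k] z = a m
      · obtain ⟨z, hz, hxz, hzy, hzm⟩ := hin
        rw [if_pos ⟨z, hz, hxz, hzy, hzm⟩, if_pos ⟨z, hz, hzy, hzm⟩, if_neg, sub_zero]
        rintro ⟨z', hz', hz'x, hz'm⟩
        have := hinj k hk hz hz' (hzm.trans hz'm.symm)
        linarith
      · rw [if_neg hin, sub_nonneg]
        by_cases hlow : ∃ z ∈ T, z < x ∧ f^[k] z = a m
        · obtain ⟨z, hz, hzx, hzm⟩ := hlow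
          rw [if_pos ⟨z, hz, hzx, hzm⟩, if_pos ⟨z, hz, hzx.trans hxy, hzm⟩]
        · rw [if_neg hlow]
          split_ifs
          exacts [hnonneg m, le_rfl]
end

section
/- Let f : [0,1] → [0,1] be continuous, and let 𝓘¹ and 𝓘² be cycles of f with q₁ and q₂ intervals respectively, such that every interval of 𝓘² is contained in some interval of 𝓘¹. Then q₁ divides q₂, and every interval of 𝓘¹ contains exactly q₂/q₁ intervals of 𝓘². -/
theorem IsCycle.iterate_mem {f : ℝ → ℝ} {q : ℕ} {I : ℕ → Set ℝ} (h : IsCycle f q I)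
    {i : ℕ} (hi : i < q) {x : ℝ} (hx : x ∈ I i) (n : ℕ) : f^[n] x ∈ I ((i + n) % q) := by
  obtain ⟨hq, -, -, -, himg⟩ := h
  induction n with
  | zero => simpa [Nat.mod_eq_of_lt hi] using hx
  | succ n ih =>
    rw [Function.iterate_succ_apply']
    have := himg _ (Nat.mod_lt (i + n) hq) ⟨_, ih, rfl⟩
    rwa [Nat.mod_add_mod, add_assoc] at this

theorem IsCycle.index_eq_of_mem {f : ℝ → ℝ} {q : ℕ} {I : ℕ → Set ℝ} (h : IsCycle f q I)
    {i j : ℕ} (hi : i < q) (hj : j < q) {x : ℝ} (hxi : x ∈ I i) (hxj : x ∈ I j) : i = j := by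
  by_contra hne
  exact Set.disjoint_left.mp (h.2.2.2.1 i hi j hj hne) hxi hxj

/-- If `𝓘¹` and `𝓘²` are cycles of a continuous map `f : [0,1] → [0,1]` with `q₁`
and `q₂` intervals, and every interval of `𝓘²` is contained in some interval of `𝓘¹`,
then `q₁ ∣ q₂` and every interval of `𝓘¹` contains exactly `q₂ / q₁` intervals
of `𝓘²`. -/
theorem cycle_nested_card (f : ℝ → ℝ)
    (hf : ContinuousOn f (Set.Icc 0 1))
    (hmaps : Set.MapsTo f (Set.Icc 0 1) (Set.Icc 0 1))
    (q₁ q₂ : ℕ) (I1 I2 : ℕ → Set ℝ)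
    (h1 : IsCycle f q₁ I1) (h2 : IsCycle f q₂ I2)
    (hsub : ∀ j < q₂, ∃ i < q₁, I2 j ⊆ I1 i) :
    q₁ ∣ q₂ ∧ ∀ i < q₁, Set.ncard {j | j < q₂ ∧ I2 j ⊆ I1 i} = q₂ / q₁ := by
  have hq₁ : 0 < q₁ := h1.1
  have hq₂ : 0 < q₂ := h2.1
  obtain ⟨u, v, huv, hI⟩ := h2.2.1 0 hq₂
  have hx : u ∈ I2 0 := hI ▸ Set.left_mem_Icc.mpr huv.le
  obtain ⟨k, hk, hk0⟩ := hsub 0 hq₂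
  have hx1 (n : ℕ) : f^[n] u ∈ I1 ((k + n) % q₁) := h1.iterate_mem hk (hk0 hx) n
  have hx2 (n : ℕ) : f^[n] u ∈ I2 (n % q₂) := by simpa using h2.iterate_mem hq₂ hx n
  have hdvd : q₁ ∣ q₂ := by
    have hmem : f^[q₂] u ∈ I1 k := hk0 (by simpa using hx2 q₂)
    have heq := h1.index_eq_of_mem (Nat.mod_lt _ hq₁) hk (hx1 q₂) hmem
    have hmod : k + q₂ ≡ k + 0 [MOD q₁] := by
      rw [Nat.ModEq, heq, add_zero, Nat.mod_eq_of_lt hk]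
    exact (Nat.modEq_zero_iff_dvd).mp (Nat.ModEq.add_left_cancel' k hmod)
  refine ⟨hdvd, fun i hi => ?_⟩
  have hsub_iff (j : ℕ) (hj : j < q₂) : I2 j ⊆ I1 i ↔ j ≡ i + (q₁ - k) [MOD q₁] := by
    have hxj : f^[j] u ∈ I2 j := by simpa [Nat.mod_eq_of_lt hj] using hx2 j
    have hindex (m : ℕ) (hm : m < q₁) (hjm : I2 j ⊆ I1 m) : (k + j) % q₁ = m :=
      h1.index_eq_of_mem (Nat.mod_lt _ hq₁) hm (hx1 j) (hjm hxj)
    have hmod : (k + j) % q₁ = i ↔ j ≡ i + (q₁ - k) [MOD q₁] := by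
      have hshift : k + (i + (q₁ - k)) = i + q₁ := by omega
      rw [← Nat.ModEq.add_iff_left (Nat.ModEq.refl k), hshift, Nat.ModEq,
        Nat.add_mod_right, Nat.mod_eq_of_lt hi]
    rw [← hmod]
    refine ⟨hindex i hi, fun h => ?_⟩
    obtain ⟨m, hm, hjm⟩ := hsub j hj
    rwa [← h, hindex m hm hjm]
  have hset : {j | j < q₂ ∧ I2 j ⊆ I1 i} =
      ((Finset.range q₂).filter (· ≡ i + (q₁ - k) [MOD q₁]) : Finset ℕ) := by
    ext j
    simpa using hsub_iff j
  rw [hset, Set.ncard_coe_finset, ← Nat.count_eq_card_filter_range,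
    Nat.count_modEq_card _ hq₁, Nat.mod_eq_zero_of_dvd hdvd]
  simp
end

section
/- Let I be a nondegenerate compact interval and let g : I → I be a continuous map that is affine with nonzero slope on each of m subintervals partitioning I, and suppose the total variation of log|Dg| over I is at most V. Then |Dg(x)| ≤ m·e^V for every point x at which g is differentiable. -/
/-- Two terms of a finite real sequence differ by at most the variation of the sequence. -/
lemma abs_sub_le_sum_range_abs_sub (u : ℕ → ℝ) {m i j : ℕ} (hi : i < m) (hj : j < m) :
    |u i - u j| ≤ ∑ k ∈ Finset.range (m - 1), |u (k + 1) - u k| := by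
  wlog hij : i ≤ j generalizing i j
  · rw [abs_sub_comm]
    exact this hj hi (le_of_not_ge hij)
  rw [abs_sub_comm, ← Finset.sum_Ico_sub u hij]
  refine (Finset.abs_sum_le_sum_abs _ _).trans
    (Finset.sum_le_sum_of_subset_of_nonneg (fun k hk => ?_) fun _ _ _ => abs_nonneg _)
  simp only [Finset.mem_Ico, Finset.mem_range] at hk ⊢
  omega

/-- Consecutive closed intervals cover the closed interval between the extreme endpoints. -/
lemma exists_mem_Icc_succ (t : ℕ → ℝ) {m : ℕ} (hm : 1 ≤ m) {x : ℝ}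
    (hx : x ∈ Set.Icc (t 0) (t m)) : ∃ i < m, x ∈ Set.Icc (t i) (t (i + 1)) := by
  induction m, hm using Nat.le_induction with
  | base => exact ⟨0, one_pos, hx⟩
  | succ m _ ih =>
    rcases le_total x (t m) with h | h
    · obtain ⟨i, hi, hxi⟩ := ih ⟨hx.1, h⟩
      exact ⟨i, by omega, hxi⟩
    · exact ⟨m, by omega, h, hx.2⟩

/-- If increments `t (j + 1) - t j` multiplied by `|s j|` are at most the total increment,
then some `|s j|` is at most the number of increments. -/
lemma exists_abs_slope_le (t s : ℕ → ℝ) {m : ℕ} (hm : 1 ≤ m)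
    (hmono : ∀ i < m, t i < t (i + 1))
    (h : ∀ i < m, |s i| * (t (i + 1) - t i) ≤ t m - t 0) : ∃ j < m, |s j| ≤ m := by
  by_contra! hlt
  have hsum : ∑ i ∈ Finset.range m, (m : ℝ) * (t (i + 1) - t i)
      < ∑ _i ∈ Finset.range m, (t m - t 0) := by
    refine Finset.sum_lt_sum_of_nonempty (Finset.nonempty_range_iff.2 (by omega)) fun i hi => ?_
    have hi := Finset.mem_range.1 hi
    exact (mul_lt_mul_of_pos_right (hlt i hi) (sub_pos.2 (hmono i hi))).trans_le (h i hi)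
  rw [← Finset.mul_sum, Finset.sum_range_sub, Finset.sum_const, Finset.card_range,
    nsmul_eq_mul] at hsum
  exact lt_irrefl _ hsum

/-- A continuous self-map `g` of a nondegenerate compact interval `[a,b]` that is
affine with nonzero slope on each of `m` subintervals of a partition of `[a,b]`, with
total variation of `log |Dg|` at most `V`, satisfies `|Dg(x)| ≤ m·e^V` wherever `g`
is differentiable. -/
theorem slope_bound_of_variation (g : ℝ → ℝ) (a b : ℝ) (hab : a < b)
    (m : ℕ) (hm : 1 ≤ m) (t s c : ℕ → ℝ)
    (ht0 : t 0 = a) (htm : t m = b) (hmono : ∀ i < m, t i < t (i + 1))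
    (hcont : ContinuousOn g (Set.Icc a b))
    (hmaps : Set.MapsTo g (Set.Icc a b) (Set.Icc a b))
    (hs : ∀ i < m, s i ≠ 0)
    (haff : ∀ i < m, ∀ x ∈ Set.Icc (t i) (t (i + 1)), g x = s i * x + c i)
    (V : ℝ)
    (hV : (∑ i ∈ Finset.range (m - 1),
      |Real.log (|s (i + 1)|) - Real.log (|s i|)|) ≤ V) :
    ∀ x ∈ Set.Icc a b, DifferentiableWithinAt ℝ g (Set.Icc a b) x →
      |derivWithin g (Set.Icc a b) x| ≤ m * Real.exp V := by
  have hle : ∀ p q, p ≤ q → q ≤ m → t p ≤ t q := by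
    intro p q hpq
    induction q, hpq using Nat.le_induction with
    | base => exact fun _ => le_rfl
    | succ q _ ih => exact fun hq => (ih (by omega)).trans (hmono q (by omega)).le
  have hsub : ∀ i < m, Set.Icc (t i) (t (i + 1)) ⊆ Set.Icc a b := fun i hi =>
    Set.Icc_subset_Icc (ht0 ▸ hle 0 i (Nat.zero_le _) hi.le) (htm ▸ hle (i + 1) m hi le_rfl)
  intro x hx hdiff
  obtain ⟨i, hi, hxi⟩ := exists_mem_Icc_succ t hm (x := x) (by rwa [ht0, htm])
  have hderiv : derivWithin g (Set.Icc a b) x = s i := by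
    have hu := uniqueDiffOn_Icc (hmono i hi) x hxi
    have haffine : HasDerivWithinAt (fun y => s i * y + c i) (s i)
        (Set.Icc (t i) (t (i + 1))) x := by
      simpa using (((hasDerivAt_id x).const_mul (s i)).add_const (c i)).hasDerivWithinAt
    rw [← derivWithin_subset (hsub i hi) hu hdiff]
    exact (haffine.congr (haff i hi) (haff i hi x hxi)).derivWithin hu
  obtain ⟨j, hj, hsj⟩ := exists_abs_slope_le t s hm hmono fun j hj => by
    have hl := Set.left_mem_Icc.2 (hmono j hj).le
    have hr := Set.right_mem_Icc.2 (hmono j hj).le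
    have hgl := hmaps (hsub j hj hl)
    have hgr := hmaps (hsub j hj hr)
    rw [ht0, htm, ← abs_of_pos (sub_pos.2 (hmono j hj)), ← abs_mul]
    have heq : s j * (t (j + 1) - t j) = g (t (j + 1)) - g (t j) := by
      rw [haff j hj _ hl, haff j hj _ hr]
      ring
    rw [heq, abs_le]
    constructor <;> linarith [hgl.1, hgl.2, hgr.1, hgr.2]
  have hlog := (le_abs_self _).trans
    ((abs_sub_le_sum_range_abs_sub (fun k => Real.log |s k|) hi hj).trans hV)
  have hpi := abs_pos.2 (hs i hi)
  have hpj := abs_pos.2 (hs j hj)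
  rw [hderiv]
  calc |s i| = Real.exp (Real.log |s i|) := (Real.exp_log hpi).symm
    _ ≤ Real.exp (Real.log |s j| + V) := Real.exp_le_exp.2 (by linarith)
    _ = |s j| * Real.exp V := by rw [Real.exp_add, Real.exp_log hpj]
    _ ≤ m * Real.exp V := by gcongr
end

section
/- Let f ∈ PL([0,1]) have nested cycles 𝓘¹ ⊃ 𝓘² with a splitting P, and assume C_f is contained in the interior of ∪𝓘² (each corner point lies in the interior of an interval of 𝓘²). Then f is differentiable at every point of ∂(∪𝓘¹), of ∂(∪𝓘²), and of P, and the following identity holds: Σ_{y ∈ ∂(∪𝓘²)} log|Df(y)| = Σ_{z ∈ ∂(∪𝓘¹)} log|Df(z)| + 2·Σ_{x ∈ P} log|Df(x)|. -/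
/-- The closed intervals `[u j, v j]` are nondegenerate and pairwise disjoint. -/
def IsIntervalFamily {ι : Type*} (u v : ι → ℝ) : Prop :=
  (∀ j, u j < v j) ∧ ∀ i j, i ≠ j → v i < u j ∨ v j < u i

/-- `(v l, u r)` is a gap between two adjacent intervals of a family, both contained in
`[s, t]`. -/
def IsGapIn {κ : Type*} (u v : κ → ℝ) (l r : κ) (s t : ℝ) : Prop :=
  v l < u r ∧ s ≤ v l ∧ u r ≤ t ∧ ∀ k, v k ≤ v l ∨ u r ≤ u k

lemma IsIntervalFamily.neg {ι : Type*} {u v : ι → ℝ} (h : IsIntervalFamily u v) :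
    IsIntervalFamily (fun j => -v j) (fun j => -u j) :=
  ⟨fun j => neg_lt_neg (h.1 j), fun i j hij => by
    rcases h.2 i j hij with h | h
    · exact Or.inr (neg_lt_neg h)
    · exact Or.inl (neg_lt_neg h)⟩

lemma isGapIn_neg {κ : Type*} {u v : κ → ℝ} {l r : κ} {s t : ℝ} :
    IsGapIn (fun j => -v j) (fun j => -u j) r l (-t) (-s) ↔ IsGapIn u v l r s t := by
  simp only [IsGapIn, neg_lt_neg_iff, neg_le_neg_iff]
  constructor
  · rintro ⟨h1, h2, h3, h4⟩
    exact ⟨h1, h3, h2, fun k => (h4 k).symm⟩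
  · rintro ⟨h1, h2, h3, h4⟩
    exact ⟨h1, h3, h2, fun k => (h4 k).symm⟩

/-- Two intervals of a disjoint family with a common point coincide. -/
lemma IsIntervalFamily.eq_of_mem {ι : Type*} {u v : ι → ℝ} (h : IsIntervalFamily u v) {i j : ι}
    {x : ℝ} (hi : u i ≤ x) (hi' : x ≤ v i) (hj : u j ≤ x) (hj' : x ≤ v j) : i = j := by
  by_contra hij
  rcases h.2 i j hij with h | h <;> linarith

/-- `u j` is the first left endpoint to the right of `x`, in the same outer interval. -/
def IsNextLeft {ι κ : Type*} (u₁ v₁ : ι → ℝ) (u₂ v₂ : κ → ℝ) (x : ℝ) (j : κ) : Prop :=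
  x ≤ u₂ j ∧ (∀ k, v₂ k ≤ x ∨ u₂ j ≤ u₂ k) ∧ ∃ i, u₁ i ≤ x ∧ u₂ j ≤ v₁ i

section

variable {ι κ : Type*} {u₁ v₁ : ι → ℝ} {u₂ v₂ : κ → ℝ} {P : Set ℝ}

lemma exists_isNextLeft_left [Finite κ] (h₁ : IsIntervalFamily u₁ v₁)
    (hsub : ∀ j, ∃ i, u₁ i ≤ u₂ j ∧ v₂ j ≤ v₁ i) (h₂ : IsIntervalFamily u₂ v₂)
    (hsurj : ∀ i, ∃ j, u₁ i ≤ u₂ j ∧ v₂ j ≤ v₁ i) (i : ι) :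
    ∃ j, IsNextLeft u₁ v₁ u₂ v₂ (u₁ i) j := by
  obtain ⟨j, hj, hmin⟩ := Set.exists_min_image {j | u₁ i ≤ u₂ j ∧ v₂ j ≤ v₁ i} u₂
    (Set.toFinite _) (hsurj i)
  have hj' := h₂.1 j
  refine ⟨j, hj.1, fun k => ?_, i, le_rfl, by linarith [hj.2]⟩
  obtain ⟨i', hi'⟩ := hsub k
  have hk := h₂.1 k
  by_cases hii : i = i'
  · subst hii
    exact Or.inr (hmin k hi')
  · rcases h₁.2 i i' hii with h | h
    · right; linarith [hj.2]
    · left; linarith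

lemma isNextLeft_of_isGapIn {i : ι} {l r : κ} (hG : IsGapIn u₂ v₂ l r (u₁ i) (v₁ i)) {x : ℝ}
    (hl : v₂ l < x) (hr : x < u₂ r) : IsNextLeft u₁ v₁ u₂ v₂ x r := by
  obtain ⟨-, h2, h3, h4⟩ := hG
  exact ⟨hr.le, fun k => (h4 k).imp (fun h => h.trans hl.le) id, i, by linarith, h3⟩

lemma le_left_of_isGapIn (h₁ : IsIntervalFamily u₁ v₁) (h₂ : IsIntervalFamily u₂ v₂)
    (hsub : ∀ j, ∃ i, u₁ i ≤ u₂ j ∧ v₂ j ≤ v₁ i) {i : ι} {l r : κ}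
    (hG : IsGapIn u₂ v₂ l r (u₁ i) (v₁ i)) : u₁ i ≤ u₂ l := by
  obtain ⟨i', hi'⟩ := hsub l
  obtain ⟨h1, h2, h3, -⟩ := hG
  have := h₂.1 l
  obtain rfl := h₁.eq_of_mem h2 (by linarith) (by linarith) hi'.2
  exact hi'.1

lemma isNextLeft_injective (h₁ : IsIntervalFamily u₁ v₁) (h₂ : IsIntervalFamily u₂ v₂)
    (hsub : ∀ j, ∃ i, u₁ i ≤ u₂ j ∧ v₂ j ≤ v₁ i)
    (hP : ∀ x ∈ P, ∃ i l r, IsGapIn u₂ v₂ l r (u₁ i) (v₁ i) ∧ v₂ l < x ∧ x < u₂ r)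
    (hP' : ∀ i l r, IsGapIn u₂ v₂ l r (u₁ i) (v₁ i) → ∃! x, x ∈ P ∧ v₂ l < x ∧ x < u₂ r)
    {j : κ} (a b : ι ⊕ P) (hab : Sum.elim u₁ (↑) a ≤ (Sum.elim u₁ (↑) b : ℝ))
    (ha : IsNextLeft u₁ v₁ u₂ v₂ (Sum.elim u₁ (↑) a) j)
    (hb : IsNextLeft u₁ v₁ u₂ v₂ (Sum.elim u₁ (↑) b) j) : a = b := by
  obtain ⟨haj, hak, i₀, hi₀, hi₀'⟩ := ha
  have hbj := hb.1
  rcases b with i' | ⟨y, hy⟩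
  · simp only [Sum.elim_inl] at *
    have h' := h₁.1 i'
    obtain rfl : i₀ = i' := h₁.eq_of_mem (hi₀.trans hab) (hbj.trans hi₀') le_rfl h'.le
    rcases a with i | ⟨x, hx⟩
    · simp only [Sum.elim_inl] at *
      rw [h₁.eq_of_mem le_rfl (h₁.1 i).le hi₀ (by linarith)]
    · simp only [Sum.elim_inr] at *
      obtain ⟨i, l, r, hG, hl, hr⟩ := hP x hx
      obtain ⟨g1, g2, g3, -⟩ := hG
      obtain rfl := h₁.eq_of_mem (i := i) (j := i₀) (x := x) (by linarith) (by linarith) hi₀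
        (by linarith)
      linarith
  · simp only [Sum.elim_inr] at *
    obtain ⟨i, l, r, hG, hl, hr⟩ := hP y hy
    have hul := le_left_of_isGapIn h₁ h₂ hsub hG
    have hl2 := h₂.1 l
    have g3 := hG.2.2.1
    rcases hak l with hla | hla
    · rcases a with i' | ⟨x, hx⟩
      · simp only [Sum.elim_inl] at *
        obtain rfl := h₁.eq_of_mem (i := i) (j := i') (x := u₁ i') (by linarith) (by linarith)
          le_rfl (h₁.1 i').le
        linarith
      · simp only [Sum.elim_inr] at *
        obtain ⟨i', l', r', hG', hl', hr'⟩ := hP x hx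
        have hlx : v₂ l < x := by
          rcases hG'.2.2.2 l with h | h <;> linarith
        have := (hP' i l r hG).unique ⟨hx, hlx, by linarith⟩ ⟨hy, hl, hr⟩
        subst this
        rfl
    · linarith

lemma isNextLeft_surjective [Finite κ] (h₁ : IsIntervalFamily u₁ v₁)
    (h₂ : IsIntervalFamily u₂ v₂)
    (hsub : ∀ j, ∃ i, u₁ i ≤ u₂ j ∧ v₂ j ≤ v₁ i)
    (hP' : ∀ i l r, IsGapIn u₂ v₂ l r (u₁ i) (v₁ i) → ∃! x, x ∈ P ∧ v₂ l < x ∧ x < u₂ r)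
    (j : κ) : ∃ a : ι ⊕ P, IsNextLeft u₁ v₁ u₂ v₂ (Sum.elim u₁ (↑) a) j := by
  obtain ⟨i, hi, hi'⟩ := hsub j
  have hj := h₂.1 j
  rcases Set.eq_empty_or_nonempty {k | u₁ i ≤ u₂ k ∧ v₂ k < u₂ j} with hS | hS
  · refine ⟨Sum.inl i, hi, fun k => ?_, i, le_rfl, by linarith⟩
    by_cases hkj : k = j
    · exact Or.inr (by rw [hkj])
    rcases h₂.2 k j hkj with h | h
    · have hk : ¬ u₁ i ≤ u₂ k := fun h' => (Set.ext_iff.1 hS k).1 ⟨h', h⟩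
      obtain ⟨i', hi1, hi2⟩ := hsub k
      have hii : i ≠ i' := by rintro rfl; exact hk hi1
      have := h₂.1 k
      left
      simp only [Sum.elim_inl]
      rcases h₁.2 i i' hii with h | h <;> linarith [h₁.1 i]
    · right; linarith
  · obtain ⟨l, ⟨hl, hl'⟩, hmax⟩ := Set.exists_max_image _ v₂ (Set.toFinite _) hS
    have hll := h₂.1 l
    have hG : IsGapIn u₂ v₂ l j (u₁ i) (v₁ i) := by
      refine ⟨hl', by linarith, by linarith, fun k => ?_⟩
      by_cases hkj : k = j
      · exact Or.inr (by rw [hkj])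
      rcases h₂.2 k j hkj with h | h
      · left
        by_cases hk : u₁ i ≤ u₂ k
        · exact hmax k ⟨hk, h⟩
        by_cases hkl : k = l
        · rw [hkl]
        rcases h₂.2 k l hkl with h | h <;> linarith
      · right; linarith
    obtain ⟨x, ⟨hx, hx1, hx2⟩, -⟩ := hP' i l j hG
    exact ⟨Sum.inr ⟨x, hx⟩, isNextLeft_of_isGapIn hG hx1 hx2⟩

/-- The sum over left endpoints of the inner intervals of a function that is constant on
the closures of complementary components. -/
lemma sum_left_endpoints [Fintype ι] [Fintype κ] [Fintype P] (h₁ : IsIntervalFamily u₁ v₁)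
    (h₂ : IsIntervalFamily u₂ v₂)
    (hsub : ∀ j, ∃ i, u₁ i ≤ u₂ j ∧ v₂ j ≤ v₁ i)
    (hsurj : ∀ i, ∃ j, u₁ i ≤ u₂ j ∧ v₂ j ≤ v₁ i)
    (hP : ∀ x ∈ P, ∃ i l r, IsGapIn u₂ v₂ l r (u₁ i) (v₁ i) ∧ v₂ l < x ∧ x < u₂ r)
    (hP' : ∀ i l r, IsGapIn u₂ v₂ l r (u₁ i) (v₁ i) → ∃! x, x ∈ P ∧ v₂ l < x ∧ x < u₂ r)
    (g : ℝ → ℝ) (hg : ∀ i x y, u₁ i ≤ x → x ≤ y → y ≤ v₁ i → (∀ k, v₂ k ≤ x ∨ y ≤ u₂ k) →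
      g x = g y) :
    ∑ j, g (u₂ j) = ∑ i, g (u₁ i) + ∑ x : P, g x := by
  have hex : ∀ a : ι ⊕ P, ∃ j, IsNextLeft u₁ v₁ u₂ v₂ (Sum.elim u₁ (↑) a) j := by
    rintro (i | ⟨x, hx⟩)
    · exact exists_isNextLeft_left h₁ hsub h₂ hsurj i
    · obtain ⟨i, l, r, hG, hl, hr⟩ := hP x hx
      exact ⟨r, isNextLeft_of_isGapIn hG hl hr⟩
  choose φ hφ using hex
  have hinj : Function.Injective φ := by
    intro a b hab
    rcases le_total (Sum.elim u₁ (↑) a : ℝ) (Sum.elim u₁ (↑) b) with h | h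
    · exact isNextLeft_injective h₁ h₂ hsub hP hP' a b h (hφ a) (hab ▸ hφ b)
    · exact (isNextLeft_injective h₁ h₂ hsub hP hP' b a h (hφ b) (hab ▸ hφ a)).symm
  have hsur : Function.Surjective φ := by
    intro j
    obtain ⟨a, ha⟩ := isNextLeft_surjective h₁ h₂ hsub hP' j
    refine ⟨a, ?_⟩
    have h1 := hφ a
    have hj := h₂.1 j
    have hj' := h₂.1 (φ a)
    by_contra hne
    rcases h1.2.1 j with h | h
    · linarith [ha.1]
    rcases ha.2.1 (φ a) with h' | h'
    · linarith [h1.1]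
    · rcases h₂.2 _ _ hne with h'' | h'' <;> linarith
  have hsum : ∑ a : ι ⊕ P, g (Sum.elim u₁ (↑) a) = ∑ j, g (u₂ j) := by
    refine Fintype.sum_bijective φ ⟨hinj, hsur⟩ _ _ fun a => ?_
    obtain ⟨h1, h2, i, h3, h4⟩ := hφ a
    exact hg i _ _ h3 h1 h4 h2
  rw [← hsum, Fintype.sum_sum_type]
  simp

lemma sum_right_endpoints [Fintype ι] [Fintype κ] [Fintype P] (h₁ : IsIntervalFamily u₁ v₁)
    (h₂ : IsIntervalFamily u₂ v₂)
    (hsub : ∀ j, ∃ i, u₁ i ≤ u₂ j ∧ v₂ j ≤ v₁ i)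
    (hsurj : ∀ i, ∃ j, u₁ i ≤ u₂ j ∧ v₂ j ≤ v₁ i)
    (hP : ∀ x ∈ P, ∃ i l r, IsGapIn u₂ v₂ l r (u₁ i) (v₁ i) ∧ v₂ l < x ∧ x < u₂ r)
    (hP' : ∀ i l r, IsGapIn u₂ v₂ l r (u₁ i) (v₁ i) → ∃! x, x ∈ P ∧ v₂ l < x ∧ x < u₂ r)
    (g : ℝ → ℝ) (hg : ∀ i x y, u₁ i ≤ x → x ≤ y → y ≤ v₁ i → (∀ k, v₂ k ≤ x ∨ y ≤ u₂ k) →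
      g x = g y) :
    ∑ j, g (v₂ j) = ∑ i, g (v₁ i) + ∑ x : P, g x := by
  have : Finite {x | -x ∈ P} := (P.toFinite.preimage neg_injective.injOn).to_subtype
  have : Fintype {x | -x ∈ P} := Fintype.ofFinite _
  have key := sum_left_endpoints (P := {x | -x ∈ P}) h₁.neg h₂.neg
    (fun j => (hsub j).imp fun i h => ⟨neg_le_neg h.2, neg_le_neg h.1⟩)
    (fun i => (hsurj i).imp fun j h => ⟨neg_le_neg h.2, neg_le_neg h.1⟩)
    (fun x hx => by
      obtain ⟨i, l, r, hG, hl, hr⟩ := hP (-x) hx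
      exact ⟨i, r, l, isGapIn_neg.2 hG, by linarith, by linarith⟩)
    (fun i l r hG => by
      obtain ⟨x, ⟨hx, hx1, hx2⟩, hu⟩ := hP' i r l (isGapIn_neg.1 hG)
      refine ⟨-x, ⟨by simpa using hx, by linarith, by linarith⟩, ?_⟩
      rintro y ⟨hy, hy1, hy2⟩
      linarith [hu (-y) ⟨hy, by linarith, by linarith⟩])
    (fun x => g (-x))
    (fun i x y h1 h2 h3 h4 => (hg i (-y) (-x) (by linarith) (by linarith) (by linarith)
      fun k => (h4 k).symm.imp (by intro h; linarith) (by intro h; linarith)).symm)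
  simp only [neg_neg] at key
  rw [key]
  congr 1
  let e : {x | -x ∈ P} ≃ P := (Equiv.neg ℝ).subtypeEquiv fun x => Iff.rfl
  exact Fintype.sum_equiv e _ _ fun x => rfl

end

open Filter Topology in
lemma IsPLMap.eventually_right {f : ℝ → ℝ} (hf : IsPLMap f) {x : ℝ} (h0 : 0 ≤ x) (h1 : x < 1) :
    ∃ s, ∀ᶠ y in 𝓝[≥] x, f y = f x + s * (y - x) := by
  obtain ⟨-, -, d, a, s, c, -, ha0, had, -, -, hfa⟩ := hf
  have key : ∀ n, x < a n → ∃ i < n, a i ≤ x ∧ x < a (i + 1) := by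
    intro n
    induction n with
    | zero => intro h; linarith
    | succ n ih =>
      intro h
      rcases lt_or_ge x (a n) with h' | h'
      · obtain ⟨i, hi, hi'⟩ := ih h'
        exact ⟨i, by omega, hi'⟩
      · exact ⟨n, by omega, h', h⟩
  obtain ⟨i, hi, hi1, hi2⟩ := key d (had ▸ h1)
  refine ⟨s i, ?_⟩
  filter_upwards [Icc_mem_nhdsGE hi2] with y hy
  rw [hfa i hi y ⟨hi1.trans hy.1, hy.2⟩, hfa i hi x ⟨hi1, hi2.le⟩]
  ring

open Filter Topology in
lemma IsPLMap.eventually_left {f : ℝ → ℝ} (hf : IsPLMap f) {x : ℝ} (h0 : 0 < x) (h1 : x ≤ 1) :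
    ∃ s, ∀ᶠ y in 𝓝[≤] x, f y = f x + s * (y - x) := by
  obtain ⟨-, -, d, a, s, c, -, ha0, had, -, -, hfa⟩ := hf
  have key : ∀ n, x ≤ a n → ∃ i < n, a i < x ∧ x ≤ a (i + 1) := by
    intro n
    induction n with
    | zero => intro h; linarith
    | succ n ih =>
      intro h
      rcases le_or_gt x (a n) with h' | h'
      · obtain ⟨i, hi, hi'⟩ := ih h'
        exact ⟨i, by omega, hi'⟩
      · exact ⟨n, by omega, h', h⟩
  obtain ⟨i, hi, hi1, hi2⟩ := key d (had ▸ h1)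
  refine ⟨s i, ?_⟩
  filter_upwards [Icc_mem_nhdsLE hi1] with y hy
  rw [hfa i hi y ⟨hy.1, hy.2.trans hi2⟩, hfa i hi x ⟨hi1.le, hi2⟩]
  ring

open Filter Topology in
lemma hasDerivWithinAt_of_eventually_affine {f : ℝ → ℝ} {S : Set ℝ} {x y s : ℝ} (hy : y ∈ S)
    (h : ∀ᶠ z in 𝓝[S] y, f z = f x + s * (z - x)) : HasDerivWithinAt f s S y := by
  have : HasDerivAt (fun z => f x + s * (z - x)) s y := by
    simpa using (((hasDerivAt_id y).sub_const x).const_mul s).const_add (f x)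
  exact this.hasDerivWithinAt.congr_of_eventuallyEq h (h.self_of_nhdsWithin hy)

open Filter Topology in
lemma IsPLMap.eventually_affine {f : ℝ → ℝ} (hf : IsPLMap f) {x : ℝ} (hx : x ∈ Set.Icc (0 : ℝ) 1)
    (hxC : x ∉ cornerSet f) :
    ∃ s, ∀ᶠ y in 𝓝[Set.Icc 0 1] x, f y = f x + s * (y - x) := by
  rcases hx.1.eq_or_lt with rfl | h0
  · obtain ⟨s, hs⟩ := hf.eventually_right le_rfl zero_lt_one
    exact ⟨s, hs.filter_mono (nhdsWithin_mono _ fun y hy => hy.1)⟩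
  rcases hx.2.eq_or_lt with rfl | h1
  · obtain ⟨s, hs⟩ := hf.eventually_left zero_lt_one le_rfl
    exact ⟨s, hs.filter_mono (nhdsWithin_mono _ fun y hy => hy.2)⟩
  obtain ⟨s, hs⟩ := hf.eventually_right hx.1 h1
  obtain ⟨t, ht⟩ := hf.eventually_left h0 hx.2
  have hst : s = t := by
    by_contra hne
    refine hxC ⟨⟨h0, h1⟩, ?_⟩
    rwa [(hasDerivWithinAt_of_eventually_affine Set.self_mem_Ici hs).derivWithin
        (uniqueDiffOn_Ici x x Set.self_mem_Ici),
      (hasDerivWithinAt_of_eventually_affine Set.self_mem_Iic ht).derivWithin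
        (uniqueDiffOn_Iic x x Set.self_mem_Iic)]
  subst hst
  refine ⟨s, Eventually.filter_mono nhdsWithin_le_nhds ?_⟩
  rw [← nhdsLE_sup_nhdsGE, eventually_sup]
  exact ⟨ht, hs⟩

open Filter Topology in
/-- Away from the corners, the slope of a piecewise affine map is locally constant. -/
lemma IsPLMap.eventually_hasDerivWithinAt {f : ℝ → ℝ} (hf : IsPLMap f) {x : ℝ}
    (hx : x ∈ Set.Icc (0 : ℝ) 1) (hxC : x ∉ cornerSet f) :
    ∃ s, ∀ᶠ y in 𝓝[Set.Icc 0 1] x, HasDerivWithinAt f s (Set.Icc 0 1) y := by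
  obtain ⟨s, hs⟩ := hf.eventually_affine hx hxC
  refine ⟨s, ?_⟩
  filter_upwards [eventually_eventually_nhdsWithin.2 hs, self_mem_nhdsWithin] with y hy hyS
  exact hasDerivWithinAt_of_eventually_affine hyS hy

lemma IsPLMap.differentiableWithinAt {f : ℝ → ℝ} (hf : IsPLMap f) {x : ℝ}
    (hx : x ∈ Set.Icc (0 : ℝ) 1) (hxC : x ∉ cornerSet f) :
    DifferentiableWithinAt ℝ f (Set.Icc 0 1) x := by
  obtain ⟨s, hs⟩ := hf.eventually_hasDerivWithinAt hx hxC
  exact (hs.self_of_nhdsWithin hx).differentiableWithinAt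

open Filter Topology in
lemma IsPLMap.derivWithin_eq {f : ℝ → ℝ} (hf : IsPLMap f) {x y : ℝ} (hxy : x ≤ y)
    (hS : Set.Icc x y ⊆ Set.Icc 0 1) (hC : Disjoint (Set.Icc x y) (cornerSet f)) :
    derivWithin f (Set.Icc 0 1) x = derivWithin f (Set.Icc 0 1) y := by
  refine isPreconnected_Icc.induction₂
    (fun a b => derivWithin f (Set.Icc 0 1) a = derivWithin f (Set.Icc 0 1) b) ?_
    (fun a b c _ _ _ h h' => h.trans h') (fun a b _ _ h => h.symm)
    (Set.left_mem_Icc.2 hxy) (Set.right_mem_Icc.2 hxy)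
  intro a ha
  obtain ⟨s, hs⟩ := hf.eventually_hasDerivWithinAt (hS ha) (hC.notMem_of_mem_left ha)
  have hu : UniqueDiffOn ℝ (Set.Icc (0 : ℝ) 1) := uniqueDiffOn_Icc zero_lt_one
  filter_upwards [hs.filter_mono (nhdsWithin_mono _ hS), self_mem_nhdsWithin] with b hb hbS
  rw [hb.derivWithin (hu b (hS hbS)), (hs.self_of_nhdsWithin (hS ha)).derivWithin (hu a (hS ha))]

section

open Set Filter Topology

variable {ι : Type*} {u v : ι → ℝ}

lemma IsIntervalFamily.left_injective (h : IsIntervalFamily u v) : Function.Injective u :=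
  fun i j hij => h.eq_of_mem le_rfl (h.1 i).le hij.ge (hij ▸ (h.1 j).le)

lemma IsIntervalFamily.right_injective (h : IsIntervalFamily u v) : Function.Injective v :=
  fun i j hij => h.eq_of_mem (h.1 i).le le_rfl (hij ▸ (h.1 j).le) hij.le

lemma IsIntervalFamily.left_notMem_interior [Finite ι] (h : IsIntervalFamily u v) (j : ι) :
    u j ∉ interior (⋃ k, Icc (u k) (v k)) := by
  intro hj
  have h1 : ∀ᶠ y in 𝓝[<] u j, y ∈ ⋃ k, Icc (u k) (v k) :=
    Eventually.filter_mono nhdsWithin_le_nhds (mem_interior_iff_mem_nhds.1 hj)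
  have h2 : ∀ᶠ y in 𝓝[<] u j, ∀ k, y ∉ Icc (u k) (v k) := by
    refine eventually_all.2 fun k => ?_
    by_cases hk : v k < u j
    · filter_upwards [Ioo_mem_nhdsLT hk] with y hy hy'
      exact hy.1.not_ge hy'.2
    · have hkj : u j ≤ u k := by
        by_cases hkj : k = j
        · rw [hkj]
        · rcases h.2 k j hkj with h' | h'
          · exact absurd h' hk
          · exact ((h.1 j).trans h').le
      filter_upwards [self_mem_nhdsWithin] with y hy hy'
      exact (hkj.trans hy'.1).not_gt hy
  obtain ⟨y, hy, hy'⟩ := (h1.and h2).exists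
  obtain ⟨k, hk⟩ := mem_iUnion.1 hy
  exact hy' k hk

lemma IsIntervalFamily.right_notMem_interior [Finite ι] (h : IsIntervalFamily u v) (j : ι) :
    v j ∉ interior (⋃ k, Icc (u k) (v k)) := by
  intro hj
  have h1 : ∀ᶠ y in 𝓝[>] v j, y ∈ ⋃ k, Icc (u k) (v k) :=
    Eventually.filter_mono nhdsWithin_le_nhds (mem_interior_iff_mem_nhds.1 hj)
  have h2 : ∀ᶠ y in 𝓝[>] v j, ∀ k, y ∉ Icc (u k) (v k) := by
    refine eventually_all.2 fun k => ?_
    by_cases hk : v j < u k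
    · filter_upwards [Ioo_mem_nhdsGT hk] with y hy hy'
      exact hy.2.not_ge hy'.1
    · have hkj : v k ≤ v j := by
        by_cases hkj : k = j
        · rw [hkj]
        · rcases h.2 k j hkj with h' | h'
          · exact (h'.trans (h.1 j)).le
          · exact absurd h' hk
      filter_upwards [self_mem_nhdsWithin] with y hy hy'
      exact (hy'.2.trans hkj).not_gt hy
  obtain ⟨y, hy, hy'⟩ := (h1.and h2).exists
  obtain ⟨k, hk⟩ := mem_iUnion.1 hy
  exact hy' k hk

lemma IsIntervalFamily.frontier_iUnion [Finite ι] (h : IsIntervalFamily u v) :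
    frontier (⋃ k, Icc (u k) (v k)) = range u ∪ range v := by
  rw [(isClosed_iUnion_of_finite fun k => isClosed_Icc).frontier_eq]
  ext x
  constructor
  · rintro ⟨hx, hx'⟩
    obtain ⟨k, hk⟩ := mem_iUnion.1 hx
    rcases hk.1.eq_or_lt with h1 | h1
    · exact Or.inl ⟨k, h1⟩
    rcases hk.2.eq_or_lt with h2 | h2
    · exact Or.inr ⟨k, h2.symm⟩
    exact absurd (interior_maximal (Ioo_subset_Icc_self.trans
      (subset_iUnion (fun k => Icc (u k) (v k)) k)) isOpen_Ioo
      ⟨h1, h2⟩) hx'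
  · rintro (⟨k, rfl⟩ | ⟨k, rfl⟩)
    · exact ⟨mem_iUnion.2 ⟨k, left_mem_Icc.2 (h.1 k).le⟩, h.left_notMem_interior k⟩
    · exact ⟨mem_iUnion.2 ⟨k, right_mem_Icc.2 (h.1 k).le⟩, h.right_notMem_interior k⟩

lemma IsIntervalFamily.finsum_frontier [Fintype ι] (h : IsIntervalFamily u v) (g : ℝ → ℝ) :
    ∑ᶠ y ∈ frontier (⋃ k, Icc (u k) (v k)), g y = ∑ j, g (u j) + ∑ j, g (v j) := by
  have hd : Disjoint (range u) (range v) := by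
    rw [Set.disjoint_left]
    rintro x ⟨i, rfl⟩ ⟨j, hj⟩
    have := h.eq_of_mem le_rfl (h.1 i).le (hj ▸ (h.1 j).le) hj.ge
    subst this
    exact (h.1 i).ne hj.symm
  rw [h.frontier_iUnion, finsum_mem_union hd (finite_range u) (finite_range v),
    finsum_mem_range h.left_injective, finsum_mem_range h.right_injective,
    finsum_eq_sum_of_fintype, finsum_eq_sum_of_fintype]

lemma IsCycle.exists_intervalFamily {f : ℝ → ℝ} {q : ℕ} {I : ℕ → Set ℝ} (h : IsCycle f q I) :
    ∃ u v : Fin q → ℝ, IsIntervalFamily u v ∧ ∀ j : Fin q, I j = Icc (u j) (v j) := by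
  obtain ⟨-, hI, -, hd, -⟩ := h
  choose u v huv hIcc using fun j : Fin q => hI j j.2
  refine ⟨u, v, ⟨huv, fun i j hij => ?_⟩, hIcc⟩
  have hdij := hd i i.2 j j.2 (fun h' => hij (Fin.ext h'))
  rw [hIcc, hIcc, Set.disjoint_left] at hdij
  by_contra! hcon
  exact hdij (a := max (u i) (u j)) ⟨le_max_left _ _, max_le (huv i).le hcon.1⟩
    ⟨le_max_right _ _, max_le hcon.2 (huv j).le⟩

lemma cycleUnion_eq_iUnion {q : ℕ} {I : ℕ → Set ℝ} {u v : Fin q → ℝ}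
    (h : ∀ j : Fin q, I j = Icc (u j) (v j)) :
    cycleUnion q I = ⋃ j, Icc (u j) (v j) := by
  ext x
  simp only [cycleUnion, mem_iUnion, exists_prop, ← h]
  exact ⟨fun ⟨j, hj, hx⟩ => ⟨⟨j, hj⟩, hx⟩, fun ⟨j, hx⟩ => ⟨j, j.2, hx⟩⟩

/-- Every interval of the outer cycle contains an interval of the inner one. -/
lemma IsCycle.exists_subset_of_nested {f : ℝ → ℝ} {q₁ q₂ : ℕ} {I1 I2 : ℕ → Set ℝ}
    (h1 : IsCycle f q₁ I1) (h2 : IsCycle f q₂ I2)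
    (hnest : ∀ j < q₂, ∃ i < q₁, I2 j ⊆ I1 i) {i : ℕ} (hi : i < q₁) :
    ∃ j < q₂, I2 j ⊆ I1 i := by
  obtain ⟨hq1, -, -, hd1, hf1⟩ := h1
  obtain ⟨hq2, hI2, -, -, hf2⟩ := h2
  obtain ⟨i₀, hi₀, h0⟩ := hnest 0 hq2
  have key : ∀ n, I2 (n % q₂) ⊆ I1 ((i₀ + n) % q₁) := by
    intro n
    induction n with
    | zero => simpa [Nat.mod_eq_of_lt hi₀] using h0
    | succ n ih =>
      obtain ⟨k, hk, hsub⟩ := hnest ((n + 1) % q₂) (Nat.mod_lt _ hq2)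
      obtain ⟨a, b, hab, hIab⟩ := hI2 (n % q₂) (Nat.mod_lt _ hq2)
      have ha : a ∈ I2 (n % q₂) := hIab ▸ left_mem_Icc.2 hab.le
      have hfa1 := hf1 _ (Nat.mod_lt _ hq1) (mem_image_of_mem f (ih ha))
      have hfa2 := hf2 _ (Nat.mod_lt _ hq2) (mem_image_of_mem f ha)
      rw [Nat.mod_add_mod] at hfa1 hfa2
      have hkeq : k = (i₀ + n + 1) % q₁ := by
        by_contra hne
        exact (hd1 k hk _ (Nat.mod_lt _ hq1) hne).notMem_of_mem_left (hsub hfa2) hfa1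
      rw [← add_assoc, ← hkeq]
      exact hsub
  refine ⟨(i + q₁ - i₀) % q₂, Nat.mod_lt _ hq2, ?_⟩
  have := key (i + q₁ - i₀)
  rwa [show i₀ + (i + q₁ - i₀) = i + q₁ by omega, Nat.add_mod_right, Nat.mod_eq_of_lt hi] at this

/-- The correspondence between set-theoretic gaps contained in `[s, t]` and gaps of the
associated interval family. -/
lemma isGap_iff_isGapIn {q : ℕ} {I : ℕ → Set ℝ} {u v : Fin q → ℝ} (huv : IsIntervalFamily u v)
    (h : ∀ j : Fin q, I j = Icc (u j) (v j)) {l r : ℕ} {G : Set ℝ} {s t : ℝ} :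
    IsGap q I l r G ∧ G ⊆ Icc s t ↔ ∃ (hl : l < q) (hr : r < q),
      G = Ioo (v ⟨l, hl⟩) (u ⟨r, hr⟩) ∧ IsGapIn u v ⟨l, hl⟩ ⟨r, hr⟩ s t := by
  constructor
  · rintro ⟨⟨hl, hr, a, b, hab, rfl, ha, ha', hb, hb', hdis⟩, hG⟩
    rw [h ⟨l, hl⟩] at ha ha'
    rw [h ⟨r, hr⟩] at hb hb'
    obtain rfl : a = v ⟨l, hl⟩ :=
      le_antisymm ha.2 (ha' _ (right_mem_Icc.2 (huv.1 _).le))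
    obtain rfl : b = u ⟨r, hr⟩ :=
      le_antisymm (hb' _ (left_mem_Icc.2 (huv.1 _).le)) hb.1
    have hG' := closure_minimal hG isClosed_Icc
    rw [closure_Ioo hab.ne] at hG'
    refine ⟨hl, hr, rfl, hab, (hG' (left_mem_Icc.2 hab.le)).1,
      (hG' (right_mem_Icc.2 hab.le)).2, fun k => ?_⟩
    by_contra! hcon
    have hd := hdis k k.2
    rw [h k, Set.disjoint_left] at hd
    obtain ⟨x, hx1, hx2⟩ := exists_between
      (max_lt (lt_min hab hcon.1) (lt_min hcon.2 (huv.1 k)))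
    rw [max_lt_iff] at hx1
    rw [lt_min_iff] at hx2
    exact hd ⟨hx1.1, hx2.1⟩ ⟨hx1.2.le, hx2.2.le⟩
  · rintro ⟨hl, hr, rfl, hlt, hs, ht, hk⟩
    refine ⟨⟨hl, hr, _, _, hlt, rfl, ?_, ?_, ?_, ?_, fun j hj => ?_⟩,
      fun x hx => ⟨hs.trans hx.1.le, hx.2.le.trans ht⟩⟩
    · exact h ⟨l, hl⟩ ▸ right_mem_Icc.2 (huv.1 _).le
    · exact fun y hy => (h ⟨l, hl⟩ ▸ hy : y ∈ Icc _ _).2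
    · exact h ⟨r, hr⟩ ▸ left_mem_Icc.2 (huv.1 _).le
    · exact fun y hy => (h ⟨r, hr⟩ ▸ hy : y ∈ Icc _ _).1
    · rw [h ⟨j, hj⟩, Set.disjoint_left]
      intro x hx hx'
      rcases hk ⟨j, hj⟩ with h' | h'
      · exact (hx'.2.trans h').not_gt hx.1
      · exact (h'.trans hx'.1).not_gt hx.2

end

/-- **Claim 3 of Theorem C.** For nested cycles `𝓘¹ ⊃ 𝓘²` with a splitting `P` and all
corner points in the interior of `∪𝓘²`, the map `f` is differentiable at all points
of `∂(∪𝓘¹)`, `∂(∪𝓘²)` and `P`, and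
`Σ_{y ∈ ∂(∪𝓘²)} log |Df(y)| = Σ_{z ∈ ∂(∪𝓘¹)} log |Df(z)| + 2 Σ_{x ∈ P} log |Df(x)|`. -/
theorem boundary_sum_identity (f : ℝ → ℝ) (hf : IsPLMap f)
    (q₁ q₂ : ℕ) (I1 I2 : ℕ → Set ℝ) (P : Set ℝ)
    (h1 : IsCycle f q₁ I1) (h2 : IsCycle f q₂ I2)
    (hnest : CycleNested q₁ I1 q₂ I2)
    (hP : IsSplitting f q₁ I1 q₂ I2 P)
    (hC : cornerSet f ⊆ interior (cycleUnion q₂ I2)) :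
    (∀ y ∈ frontier (cycleUnion q₁ I1), DifferentiableWithinAt ℝ f (Set.Icc 0 1) y) ∧
    (∀ y ∈ frontier (cycleUnion q₂ I2), DifferentiableWithinAt ℝ f (Set.Icc 0 1) y) ∧
    (∀ x ∈ P, DifferentiableWithinAt ℝ f (Set.Icc 0 1) x) ∧
    (∑ᶠ y ∈ frontier (cycleUnion q₂ I2), Real.log (|derivWithin f (Set.Icc 0 1) y|)) =
      (∑ᶠ z ∈ frontier (cycleUnion q₁ I1), Real.log (|derivWithin f (Set.Icc 0 1) z|)) +
        2 * ∑ᶠ x ∈ P, Real.log (|derivWithin f (Set.Icc 0 1) x|) := by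
  obtain ⟨u₁, v₁, hF1, hI1⟩ := h1.exists_intervalFamily
  obtain ⟨u₂, v₂, hF2, hI2⟩ := h2.exists_intervalFamily
  have hU1 := cycleUnion_eq_iUnion hI1
  have hU2 := cycleUnion_eq_iUnion hI2
  have hsub : ∀ j : Fin q₂, ∃ i : Fin q₁, u₁ i ≤ u₂ j ∧ v₂ j ≤ v₁ i := by
    intro j
    obtain ⟨i, hi, hji⟩ := hnest.1 j j.2
    rw [hI2 j, hI1 ⟨i, hi⟩, Set.Icc_subset_Icc_iff (hF2.1 j).le] at hji
    exact ⟨⟨i, hi⟩, hji⟩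
  have hsurj : ∀ i : Fin q₁, ∃ j : Fin q₂, u₁ i ≤ u₂ j ∧ v₂ j ≤ v₁ i := by
    intro i
    obtain ⟨j, hj, hji⟩ := h1.exists_subset_of_nested h2 hnest.1 i.2
    rw [hI2 ⟨j, hj⟩, hI1 i, Set.Icc_subset_Icc_iff (hF2.1 _).le] at hji
    exact ⟨⟨j, hj⟩, hji⟩
  have hI01 : ∀ i : Fin q₁, Set.Icc (u₁ i) (v₁ i) ⊆ Set.Icc 0 1 := fun i =>
    hI1 i ▸ h1.2.2.1 i i.2
  obtain ⟨hPfin, -, -, hPgap, hPex⟩ := hP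
  have hP1 : ∀ x ∈ P, ∃ i l r, IsGapIn u₂ v₂ l r (u₁ i) (v₁ i) ∧ v₂ l < x ∧ x < u₂ r := by
    intro x hx
    obtain ⟨i, hi, l, r, G, hG, hGi, hxG⟩ := hPgap x hx
    rw [hI1 ⟨i, hi⟩] at hGi
    obtain ⟨hl, hr, rfl, hgap⟩ := (isGap_iff_isGapIn hF2 hI2).1 ⟨hG, hGi⟩
    exact ⟨⟨i, hi⟩, _, _, hgap, hxG.1, hxG.2⟩
  have hP2 : ∀ i l r, IsGapIn u₂ v₂ l r (u₁ i) (v₁ i) →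
      ∃! x, x ∈ P ∧ v₂ l < x ∧ x < u₂ r := by
    intro i l r hgap
    obtain ⟨hG, hGi⟩ := (isGap_iff_isGapIn hF2 hI2).2 ⟨l.2, r.2, rfl, hgap⟩
    rw [← hI1 i] at hGi
    exact hPex i i.2 l r _ hG hGi
  have hUsub : cycleUnion q₂ I2 ⊆ cycleUnion q₁ I1 := by
    rw [hU1, hU2]
    refine Set.iUnion_subset fun j => ?_
    obtain ⟨i, hi, hi'⟩ := hsub j
    exact (Set.Icc_subset_Icc hi hi').trans (Set.subset_iUnion_of_subset i subset_rfl)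
  have hcl1 : IsClosed (cycleUnion q₁ I1) := by
    rw [hU1]; exact isClosed_iUnion_of_finite fun _ => isClosed_Icc
  have hcl2 : IsClosed (cycleUnion q₂ I2) := by
    rw [hU2]; exact isClosed_iUnion_of_finite fun _ => isClosed_Icc
  have hU01 : cycleUnion q₁ I1 ⊆ Set.Icc 0 1 := by
    rw [hU1]; exact Set.iUnion_subset hI01
  have hclosure : ∀ {x y : ℝ}, x < y → (∀ k, v₂ k ≤ x ∨ y ≤ u₂ k) →
      Disjoint (Set.Icc x y) (interior (cycleUnion q₂ I2)) := by
    intro x y hxy hk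
    rw [← closure_Ioo hxy.ne]
    refine Disjoint.closure_left ?_ isOpen_interior
    refine Disjoint.mono_right interior_subset ?_
    rw [hU2, Set.disjoint_iUnion_right]
    intro k
    rw [Set.disjoint_left]
    intro z hz hz'
    rcases hk k with h | h
    · exact (hz'.2.trans h).not_gt hz.1
    · exact (h.trans hz'.1).not_gt hz.2
  refine ⟨fun y hy => ?_, fun y hy => ?_, fun x hx => ?_, ?_⟩
  · rw [hcl1.frontier_eq] at hy
    exact hf.differentiableWithinAt (hU01 hy.1) fun h => hy.2 (interior_mono hUsub (hC h))
  · rw [hcl2.frontier_eq] at hy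
    exact hf.differentiableWithinAt (hU01 (hUsub hy.1)) fun h => hy.2 (hC h)
  · obtain ⟨i, l, r, ⟨hlr, hl, hr, hk⟩, hxl, hxr⟩ := hP1 x hx
    exact hf.differentiableWithinAt (hI01 i ⟨by linarith, by linarith⟩)
      fun h => (hclosure hlr hk).notMem_of_mem_left ⟨hxl.le, hxr.le⟩ (hC h)
  · have hg : ∀ i x y, u₁ i ≤ x → x ≤ y → y ≤ v₁ i → (∀ k, v₂ k ≤ x ∨ y ≤ u₂ k) →
        Real.log (|derivWithin f (Set.Icc 0 1) x|) =
          Real.log (|derivWithin f (Set.Icc 0 1) y|) := by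
      intro i x y hx hxy hy hk
      rcases hxy.eq_or_lt with rfl | hlt
      · rfl
      · rw [hf.derivWithin_eq hxy ((Set.Icc_subset_Icc hx hy).trans (hI01 i))
          ((hclosure hlt hk).mono_right hC)]
    have : Fintype P := hPfin.fintype
    have hleft := sum_left_endpoints hF1 hF2 hsub hsurj hP1 hP2
      (fun x => Real.log (|derivWithin f (Set.Icc 0 1) x|)) hg
    have hright := sum_right_endpoints hF1 hF2 hsub hsurj hP1 hP2
      (fun x => Real.log (|derivWithin f (Set.Icc 0 1) x|)) hg
    rw [hU1, hU2, hF1.finsum_frontier, hF2.finsum_frontier, hleft, hright,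
      ← finsum_set_coe_eq_finsum_mem P, finsum_eq_sum_of_fintype]
    ring
end

section
/- Let f ∈ PL([0,1]) and let x be a periodic point of f of minimal period p such that f^p is differentiable at x and |Df^p(x)| < 1 (an attracting periodic point). Then there exists a point c ∈ C_f ∪ {0, 1} that is attracted to the orbit of x: the distance from f^n(c) to the set {x, f(x), …, f^{p−1}(x)} tends to 0 as n → ∞. -/
lemma exists_mem_Ico_succ {a : ℕ → ℝ} {y : ℝ} (h0 : a 0 ≤ y) :
    ∀ d : ℕ, y < a d → ∃ i < d, a i ≤ y ∧ y < a (i + 1)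
  | 0, h => absurd h h0.not_gt
  | d + 1, h => by
    by_cases hy : y < a d
    · obtain ⟨i, hi, hiy⟩ := exists_mem_Ico_succ h0 d hy
      exact ⟨i, by omega, hiy⟩
    · exact ⟨d, by omega, not_lt.1 hy, h⟩

lemma exists_mem_Ioc_succ {a : ℕ → ℝ} {y : ℝ} (h0 : a 0 < y) :
    ∀ d : ℕ, y ≤ a d → ∃ i < d, a i < y ∧ y ≤ a (i + 1)
  | 0, h => absurd h h0.not_ge
  | d + 1, h => by
    by_cases hy : y ≤ a d
    · obtain ⟨i, hi, hiy⟩ := exists_mem_Ioc_succ h0 d hy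
      exact ⟨i, by omega, hiy⟩
    · exact ⟨d, by omega, not_le.1 hy, h⟩

/-- `h` coincides with an affine function near `y`. -/
def LocallyAffineAt (h : ℝ → ℝ) (y : ℝ) : Prop :=
  ∃ α β : ℝ, ∀ᶠ z in nhds y, h z = α * z + β

lemma hasDerivAt_affine (α β y : ℝ) : HasDerivAt (fun z => α * z + β) α y := by
  simpa using ((hasDerivAt_id y).const_mul α).add_const β

lemma IsPLMap.locallyAffineAt {f : ℝ → ℝ} (hf : IsPLMap f) {y : ℝ}
    (hy : y ∈ Set.Ioo (0 : ℝ) 1) (hc : y ∉ cornerSet f) : LocallyAffineAt f y := by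
  obtain ⟨-, -, d, a, s, c, -, h0, h1, -, -, haff⟩ := hf
  obtain ⟨i, hi, hiy, hyi⟩ := exists_mem_Ico_succ (a := a) (y := y) (by rw [h0]; exact hy.1.le) d
    (by rw [h1]; exact hy.2)
  obtain ⟨j, hj, hjy, hyj⟩ := exists_mem_Ioc_succ (a := a) (y := y) (by rw [h0]; exact hy.1) d
    (by rw [h1]; exact hy.2.le)
  have hright : ∀ z, y ≤ z → z < a (i + 1) → f z = s i * z + c i :=
    fun z hz hz' => haff i hi z ⟨hiy.trans hz, hz'.le⟩
  have hleft : ∀ z, z ≤ y → a j < z → f z = s j * z + c j :=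
    fun z hz hz' => haff j hj z ⟨hz'.le, hz.trans hyj⟩
  have hdr : derivWithin f (Set.Ici y) y = s i := by
    refine HasDerivWithinAt.derivWithin ?_ (uniqueDiffOn_Ici y y Set.self_mem_Ici)
    refine (hasDerivAt_affine (s i) (c i) y).hasDerivWithinAt.congr_of_eventuallyEq ?_
      (hright y le_rfl hyi)
    filter_upwards [self_mem_nhdsWithin, mem_nhdsWithin_of_mem_nhds (Iio_mem_nhds hyi)]
      with z hz hz' using hright z hz hz'
  have hdl : derivWithin f (Set.Iic y) y = s j := by
    refine HasDerivWithinAt.derivWithin ?_ (uniqueDiffOn_Iic y y Set.self_mem_Iic)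
    refine (hasDerivAt_affine (s j) (c j) y).hasDerivWithinAt.congr_of_eventuallyEq ?_
      (hleft y le_rfl hjy)
    filter_upwards [self_mem_nhdsWithin, mem_nhdsWithin_of_mem_nhds (Ioi_mem_nhds hjy)]
      with z hz hz' using hleft z hz hz'
  have hs : s i = s j := by
    by_contra hne
    exact hc ⟨hy, by rwa [hdr, hdl]⟩
  have hcc : c i = c j := by
    have h2 := hright y le_rfl hyi
    rw [hleft y le_rfl hjy, hs] at h2
    linarith
  refine ⟨s i, c i, ?_⟩
  filter_upwards [Ioo_mem_nhds hjy hyi] with z hz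
  rcases le_total y z with h | h
  · exact hright z h hz.2
  · rw [hleft z h hz.1, hs, hcc]

lemma LocallyAffineAt.iterate {f : ℝ → ℝ} {y : ℝ} :
    ∀ n : ℕ, (∀ k, LocallyAffineAt f (f^[k] y)) → LocallyAffineAt f^[n] y
  | 0, _ => ⟨1, 0, by simp⟩
  | n + 1, h => by
    obtain ⟨α, β, hn⟩ := LocallyAffineAt.iterate n h
    obtain ⟨γ, δ, hk⟩ := h n
    have hcont : Filter.Tendsto f^[n] (nhds y) (nhds (f^[n] y)) := by
      have h1 : ContinuousAt (fun z => α * z + β) y := by fun_prop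
      exact (h1.congr (hn.mono fun z hz => hz.symm)).tendsto
    refine ⟨γ * α, γ * β + δ, ?_⟩
    filter_upwards [hn, hcont.eventually hk] with z hz hz'
    rw [Function.iterate_succ_apply', hz', hz]
    ring

/-- The point `y` is attracted to the first `p` points of the orbit of `x`. -/
def AttractedTo (f : ℝ → ℝ) (x : ℝ) (p : ℕ) (y : ℝ) : Prop :=
  Filter.Tendsto (fun n => Metric.infDist (f^[n] y) ((fun k => f^[k] x) '' Set.Iio p))
    Filter.atTop (nhds 0)

lemma AttractedTo.iterate {f : ℝ → ℝ} {x y : ℝ} {p : ℕ} (h : AttractedTo f x p y) (k : ℕ) :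
    AttractedTo f x p (f^[k] y) := by
  have := (Filter.tendsto_add_atTop_iff_nat k).2 h
  simpa only [AttractedTo, Function.iterate_add_apply] using this

/-- Convergence along the `p`-th iterate implies attraction to the whole orbit. -/
lemma attractedTo_of_tendsto {f : ℝ → ℝ} {s : Set ℝ} (hf : ContinuousOn f s)
    (hs : Set.MapsTo f s s) {x y : ℝ} {p : ℕ} (hp : 1 ≤ p) (hx : x ∈ s) (hy : y ∈ s)
    (h : Filter.Tendsto (fun n => (f^[p])^[n] y) Filter.atTop (nhds x)) :
    AttractedTo f x p y := by
  have hw : Filter.Tendsto (fun n => (f^[p])^[n] y) Filter.atTop (nhdsWithin x s) :=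
    tendsto_nhdsWithin_iff.2 ⟨h, .of_forall fun n => (hs.iterate p).iterate n hy⟩
  have hj : ∀ j, Filter.Tendsto (fun n => f^[j] ((f^[p])^[n] y)) Filter.atTop
      (nhds (f^[j] x)) := fun j =>
    ((hf.iterate hs j) x hx).tendsto.comp hw
  rw [AttractedTo, Metric.tendsto_atTop]
  intro ε hε
  have hall : ∀ᶠ q in Filter.atTop, ∀ j ∈ Set.Iio p,
      dist (f^[j] ((f^[p])^[q] y)) (f^[j] x) < ε :=
    (Filter.eventually_all_finite (Set.finite_Iio p)).2 fun j _ =>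
      (hj j).eventually (Metric.ball_mem_nhds _ hε)
  obtain ⟨N, hN⟩ := Filter.eventually_atTop.1 hall
  refine ⟨p * N, fun n hn => ?_⟩
  have hlt : n % p < p := Nat.mod_lt _ hp
  have hq := hN (n / p) ((Nat.le_div_iff_mul_le hp).2 (by rwa [mul_comm])) (n % p) hlt
  rw [← Function.iterate_mul, ← Function.iterate_add_apply, Nat.mod_add_div] at hq
  rw [Real.dist_0_eq_abs, abs_of_nonneg Metric.infDist_nonneg]
  have hmem : f^[n % p] x ∈ (fun k => f^[k] x) '' Set.Iio p :=
    Set.mem_image_of_mem (fun k => f^[k] x) (Set.mem_Iio.2 hlt)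
  exact (Metric.infDist_le_dist_of_mem hmem).trans_lt hq

/-- A map which is affine with slope `m`, `|m| < 1`, on an interval centred at its fixed point
`x` contracts that interval to `x`. -/
lemma tendsto_iterate_of_affine {g : ℝ → ℝ} {x m r : ℝ} (hm : |m| < 1)
    (hg : ∀ y ∈ Set.Icc (x - r) (x + r), g y = x + m * (y - x)) {y : ℝ}
    (hy : y ∈ Set.Icc (x - r) (x + r)) :
    Filter.Tendsto (fun n => g^[n] y) Filter.atTop (nhds x) := by
  have hiter : ∀ n, g^[n] y = x + m ^ n * (y - x) := by
    intro n
    induction n with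
    | zero => simp
    | succ n ih =>
      have hmem : x + m ^ n * (y - x) ∈ Set.Icc (x - r) (x + r) := by
        have h1 : |y - x| ≤ r := abs_le.2 ⟨by linarith [hy.1], by linarith [hy.2]⟩
        have h2 : |m ^ n * (y - x)| ≤ r := by
          rw [abs_mul, abs_pow]
          exact (mul_le_of_le_one_left (abs_nonneg _)
            (pow_le_one₀ (abs_nonneg m) hm.le)).trans h1
        obtain ⟨h3, h4⟩ := abs_le.1 h2
        exact ⟨by linarith, by linarith⟩
      rw [Function.iterate_succ_apply', ih, hg _ hmem]
      ring
  simp only [hiter]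
  simpa using ((tendsto_pow_atTop_nhds_zero_of_abs_lt_one hm).mul_const (y - x)).const_add x

/-- Local affineness at a boundary point `y` of a segment `[y, w]` (in either order) on which
`g` is affine extends the affine formula past `y`. -/
lemma LocallyAffineAt.eventually_eq {g : ℝ → ℝ} {y w m b : ℝ} (h : LocallyAffineAt g y)
    (hwy : w ≠ y) (hg : ∀ z ∈ Set.uIcc y w, g z = m * z + b) :
    ∀ᶠ z in nhds y, g z = m * z + b := by
  obtain ⟨α, β, hev⟩ := h
  have hpath : Filter.Tendsto (fun t : ℝ => y + t * (w - y)) (nhdsWithin 0 (Set.Ioi 0))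
      (nhds y) := by
    have : ContinuousAt (fun t : ℝ => y + t * (w - y)) 0 := by fun_prop
    simpa using this.tendsto.mono_left nhdsWithin_le_nhds
  obtain ⟨t, ht, ht0, ht1⟩ := ((hpath.eventually hev).and
    (Ioo_mem_nhdsGT (zero_lt_one (α := ℝ)))).exists
  have hmem : y + t * (w - y) ∈ Set.uIcc y w := by
    rcases le_total y w with hle | hle
    · rw [Set.uIcc_of_le hle]
      constructor <;> nlinarith
    · rw [Set.uIcc_of_ge hle]
      constructor <;> nlinarith
  have e1 := hg _ hmem
  have e2 := hg y Set.left_mem_uIcc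
  rw [ht] at e1
  rw [hev.self_of_nhds] at e2
  have hα : α = m := by
    have : (α - m) * (t * (w - y)) = 0 := by linear_combination e1 - e2
    rcases mul_eq_zero.1 this with h | h
    · linarith
    · exact absurd h (mul_ne_zero ht0.ne' (sub_ne_zero.2 hwy))
  subst hα
  have hβ : β = b := by linarith
  exact hβ ▸ hev

/-- An attracting periodic orbit of a piecewise affine map attracts a corner point or
an endpoint of `[0,1]`. -/
theorem attracting_orbit_attracts_corner (f : ℝ → ℝ) (hf : IsPLMap f)
    (x : ℝ) (hx : x ∈ Set.Icc 0 1)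
    (p : ℕ) (hper : MinimalPeriod f x p)
    (hdiff : DifferentiableWithinAt ℝ (f^[p]) (Set.Icc 0 1) x)
    (hattr : |derivWithin (f^[p]) (Set.Icc 0 1) x| < 1) :
    ∃ c ∈ cornerSet f ∪ ({0, 1} : Set ℝ),
      Filter.Tendsto
        (fun n => Metric.infDist (f^[n] c) ((fun k => f^[k] x) '' Set.Iio p))
        Filter.atTop (nhds 0) := by
  by_contra! hno
  change ∀ c ∈ _, ¬ AttractedTo f x p c at hno
  have hcont := hf.1
  have hmaps := hf.2.1
  obtain ⟨hp, hfix, -⟩ := hper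
  have hIoo : ∀ y ∈ Set.Icc (0 : ℝ) 1, AttractedTo f x p y → y ∈ Set.Ioo (0 : ℝ) 1 := by
    intro y hy ha
    refine ⟨hy.1.lt_of_ne fun h => ?_, hy.2.lt_of_ne fun h => ?_⟩
    · exact hno y (by simp [← h]) ha
    · exact hno y (by simp [h]) ha
  have hlocal : ∀ y ∈ Set.Icc (0 : ℝ) 1, AttractedTo f x p y → LocallyAffineAt f^[p] y := by
    intro y hy ha
    refine LocallyAffineAt.iterate p fun k => ?_
    exact hf.locallyAffineAt (hIoo _ (hmaps.iterate k hy) (ha.iterate k))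
      fun hc => hno _ (Or.inl hc) (ha.iterate k)
  have hxa : AttractedTo f x p x := by
    refine attractedTo_of_tendsto hcont hmaps hp hx hx ?_
    simp only [Function.iterate_fixed hfix]
    exact tendsto_const_nhds
  have hxI := hIoo x hx hxa
  obtain ⟨m, b, hmb⟩ := hlocal x hx hxa
  have hm : |m| < 1 := by
    have hd : HasDerivAt f^[p] m x := (hasDerivAt_affine m b x).congr_of_eventuallyEq hmb
    rwa [hd.hasDerivWithinAt.derivWithin (uniqueDiffOn_Icc zero_lt_one x hx)] at hattr
  have hb : m * x + b = x := by rw [← hmb.self_of_nhds, hfix]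
  let Q : ℝ → Prop := fun y => y ∈ Set.Icc (0 : ℝ) 1 ∧ f^[p] y = m * y + b
  let S : Set ℝ := {r | ∀ y, |y - x| < r → Q y}
  have hSclosed : IsClosed S := by
    have : S = ⋂ y ∈ {y | ¬ Q y}, Set.Iic |y - x| := by
      ext r
      simp only [S, Set.mem_ofPred_eq, Set.mem_iInter, Set.mem_Iic]
      exact forall_congr' fun y => by rw [← not_lt, not_imp_not]
    rw [this]
    exact isClosed_biInter fun y _ => isClosed_Iic
  have hnear : ∀ᶠ y in nhds x, Q y := (Filter.Eventually.and
    (Icc_mem_nhds hxI.1 hxI.2) hmb)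
  obtain ⟨r₀, hr₀, hball⟩ := Metric.eventually_nhds_iff.1 hnear
  have hr₀S : r₀ ∈ S := fun y hy => hball (by rwa [Real.dist_eq])
  have hstep : ∀ r ∈ S ∩ Set.Ico r₀ (r₀ + 1), ∀ r' ∈ Set.Ioi r, (S ∩ Set.Ioc r r').Nonempty := by
    rintro r ⟨hrS, hr, -⟩ r' hr'
    have hr0 : 0 < r := hr₀.trans_le hr
    have hQ : ∀ y ∈ Set.Ioo (x - r) (x + r), Q y := fun y hy =>
      hrS y (abs_lt.2 ⟨by linarith [hy.1], by linarith [hy.2]⟩)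
    have hcl : closure (Set.Ioo (x - r) (x + r)) = Set.Icc (x - r) (x + r) :=
      closure_Ioo (by linarith)
    have hI : Set.Icc (x - r) (x + r) ⊆ Set.Icc 0 1 := by
      rw [← hcl]
      exact closure_minimal (fun y hy => (hQ y hy).1) isClosed_Icc
    have haff : Set.EqOn f^[p] (fun y => m * y + b) (Set.Icc (x - r) (x + r)) :=
      Set.EqOn.of_subset_closure (s := Set.Ioo (x - r) (x + r)) (fun y hy => (hQ y hy).2)
        ((hcont.iterate hmaps p).mono hI) (by fun_prop) Set.Ioo_subset_Icc_self hcl.ge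
    have hatt : ∀ y ∈ Set.Icc (x - r) (x + r), AttractedTo f x p y := fun y hy =>
      attractedTo_of_tendsto hcont hmaps hp hx (hI hy) <|
        tendsto_iterate_of_affine hm (fun z hz => (haff hz).trans (by linear_combination hb)) hy
    have hext : ∀ y ∈ Set.Icc (x - r) (x + r), y ≠ x → ∀ᶠ z in nhds y, Q z := by
      intro y hy hyx
      have hyI := hIoo y (hI hy) (hatt y hy)
      refine Filter.Eventually.and (Icc_mem_nhds hyI.1 hyI.2) ?_
      refine (hlocal y (hI hy) (hatt y hy)).eventually_eq hyx.symm fun z hz => haff ?_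
      exact Set.uIcc_subset_Icc hy ⟨by linarith, by linarith⟩ hz
    obtain ⟨ε₁, hε₁, h₁⟩ := Metric.eventually_nhds_iff.1
      (hext (x - r) ⟨le_rfl, by linarith⟩ (by linarith))
    obtain ⟨ε₂, hε₂, h₂⟩ := Metric.eventually_nhds_iff.1
      (hext (x + r) ⟨by linarith, le_rfl⟩ (by linarith))
    refine ⟨min (r + min ε₁ ε₂) r', fun y hy => ?_,
      lt_min (lt_add_of_pos_right r (lt_min hε₁ hε₂)) hr', min_le_right _ _⟩
    have hy' : |y - x| < r + min ε₁ ε₂ := hy.trans_le (min_le_left _ _)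
    obtain ⟨hy1, hy2⟩ := abs_lt.1 hy'
    have hm1 := min_le_left ε₁ ε₂
    have hm2 := min_le_right ε₁ ε₂
    by_cases hl : y < x - r
    · exact h₁ (by rw [Real.dist_eq, abs_lt]; constructor <;> linarith)
    by_cases hu : x + r < y
    · exact h₂ (by rw [Real.dist_eq, abs_lt]; constructor <;> linarith)
    have hyr : y ∈ Set.Icc (x - r) (x + r) := ⟨not_lt.1 hl, not_lt.1 hu⟩
    exact ⟨hI hyr, haff hyr⟩
  have hlarge : r₀ + 1 ∈ S :=
    (hSclosed.inter isClosed_Icc).Icc_subset_of_forall_exists_gt hr₀S hstep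
      ⟨by linarith, le_rfl⟩
  have := (hlarge (x + 1) (by simpa using hr₀)).1.2
  linarith [hxI.1]
end

section
/- Let f ∈ PL([0,1]) and let x be a periodic point of f of minimal period p such that f^p is differentiable at x and |Df^p(x)| = 1 (a neutral periodic point). Then some point of C_f ∪ {0, 1} is a periodic point of f. -/
open Filter Topology

/-- Every point of `(a 0, a d]` lies in some half-open interval `(a i, a (i + 1)]` with
`i < d`. -/
theorem exists_mem_Ioc_partition {a : ℕ → ℝ} {z : ℝ} :
    ∀ d : ℕ, a 0 < z → z ≤ a d → ∃ i < d, z ∈ Set.Ioc (a i) (a (i + 1))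
  | 0, h0, hd => absurd h0 (not_lt.2 hd)
  | d + 1, h0, hd => by
    rcases lt_or_ge (a d) z with h | h
    · exact ⟨d, d.lt_succ_self, h, hd⟩
    · obtain ⟨i, hi, hz⟩ := exists_mem_Ioc_partition d h0 h
      exact ⟨i, hi.trans d.lt_succ_self, hz⟩

/-- Every point of `[a 0, a d)` lies in some half-open interval `[a i, a (i + 1))` with
`i < d`. -/
theorem exists_mem_Ico_partition {a : ℕ → ℝ} {z : ℝ} :
    ∀ d : ℕ, a 0 ≤ z → z < a d → ∃ i < d, z ∈ Set.Ico (a i) (a (i + 1))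
  | 0, h0, hd => absurd h0 (not_le.2 hd)
  | d + 1, h0, hd => by
    rcases le_or_gt (a d) z with h | h
    · exact ⟨d, d.lt_succ_self, h, hd⟩
    · obtain ⟨i, hi, hz⟩ := exists_mem_Ico_partition d h0 h
      exact ⟨i, hi.trans d.lt_succ_self, hz⟩

/-- `f` agrees with an affine function near `z`. -/
def EventuallyAffine (f : ℝ → ℝ) (z : ℝ) : Prop :=
  ∃ s c : ℝ, ∀ᶠ y in 𝓝 z, f y = s * y + c

theorem hasDerivAt_mul_add_const (s c z : ℝ) : HasDerivAt (fun y => s * y + c) s z := by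
  simpa using ((hasDerivAt_id z).const_mul s).add_const c

/-- A piecewise affine map is affine near every interior point that is not a corner. -/
theorem IsPLMap.eventuallyAffine {f : ℝ → ℝ} (hf : IsPLMap f) {z : ℝ}
    (hz : z ∈ Set.Ioo (0 : ℝ) 1) (hc : z ∉ cornerSet f) : EventuallyAffine f z := by
  obtain ⟨-, -, d, a, s, c, -, h0, h1, -, -, haff⟩ := hf
  obtain ⟨i, hi, hiz⟩ := exists_mem_Ioc_partition (a := a) d (h0 ▸ hz.1) (h1 ▸ hz.2.le)
  obtain ⟨j, hj, hjz⟩ := exists_mem_Ico_partition (a := a) d (h0 ▸ hz.1.le) (h1 ▸ hz.2)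
  have hl : ∀ᶠ y in 𝓝[≤] z, f y = s i * y + c i := by
    filter_upwards [self_mem_nhdsWithin, mem_nhdsWithin_of_mem_nhds (Ioi_mem_nhds hiz.1)]
      with y hy hy'
    exact haff i hi y ⟨hy'.le, hy.trans hiz.2⟩
  have hr : ∀ᶠ y in 𝓝[≥] z, f y = s j * y + c j := by
    filter_upwards [self_mem_nhdsWithin, mem_nhdsWithin_of_mem_nhds (Iio_mem_nhds hjz.2)]
      with y hy hy'
    exact haff j hj y ⟨hjz.1.trans hy, hy'.le⟩
  have hlz := hl.self_of_nhdsWithin Set.self_mem_Iic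
  have hrz := hr.self_of_nhdsWithin Set.self_mem_Ici
  have hdl : derivWithin f (Set.Iic z) z = s i :=
    ((hasDerivAt_mul_add_const (s i) (c i) z).hasDerivWithinAt.congr_of_eventuallyEq
      hl hlz).derivWithin (uniqueDiffWithinAt_Iic z)
  have hdr : derivWithin f (Set.Ici z) z = s j :=
    ((hasDerivAt_mul_add_const (s j) (c j) z).hasDerivWithinAt.congr_of_eventuallyEq
      hr hrz).derivWithin (uniqueDiffWithinAt_Ici z)
  have hs : s j = s i := by
    by_contra hne
    exact hc ⟨hz, by rwa [hdl, hdr]⟩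
  have hcc : c j = c i := by
    rw [hs] at hrz
    linarith
  rw [hs, hcc] at hr
  refine ⟨s i, c i, ?_⟩
  rw [← nhdsLE_sup_nhdsGE]
  exact eventually_sup.2 ⟨hl, hr⟩

theorem EventuallyAffine.continuousAt {f : ℝ → ℝ} {z : ℝ} (h : EventuallyAffine f z) :
    ContinuousAt f z := by
  obtain ⟨s, c, h⟩ := h
  exact ((hasDerivAt_mul_add_const s c z).congr_of_eventuallyEq h).continuousAt

/-- If `f` is affine near every point of the orbit of `z`, then its iterates are affine
near `z`. -/
theorem EventuallyAffine.iterate {f : ℝ → ℝ} {z : ℝ}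
    (h : ∀ k, EventuallyAffine f (f^[k] z)) (n : ℕ) : EventuallyAffine f^[n] z := by
  induction n with
  | zero => exact ⟨1, 0, by simp⟩
  | succ n ih =>
    have hcont := ih.continuousAt
    obtain ⟨s, c, hsc⟩ := ih
    obtain ⟨s', c', hsc'⟩ := h n
    refine ⟨s' * s, s' * c + c', ?_⟩
    filter_upwards [hsc, hcont.eventually hsc'] with y hy hy'
    rw [Function.iterate_succ_apply', hy', hy]
    ring

/-- An affine germ at `z` that is the identity near each point of a set accumulating at `z` is the
germ of the identity. -/
theorem EventuallyAffine.eventually_eq_self {g : ℝ → ℝ} {z : ℝ} {u : Set ℝ}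
    (h : EventuallyAffine g z) (hz : z ∈ closure u)
    (hu : ∀ y ∈ u, ∀ᶠ t in 𝓝 y, g t = t) : ∀ᶠ t in 𝓝 z, g t = t := by
  obtain ⟨s, c, h⟩ := h
  obtain ⟨y, hyu, hy⟩ := ((mem_closure_iff_frequently.1 hz).and_eventually
    h.eventually_nhds).exists
  have hid : ∀ᶠ t in 𝓝 y, s * t + c = t := by
    filter_upwards [hy, hu y hyu] with t h₁ h₂
    rw [← h₁, h₂]
  have hs : s = 1 := (hasDerivAt_mul_add_const s c y).unique
    ((hasDerivAt_id y).congr_of_eventuallyEq hid)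
  have hc : c = 0 := by
    have := hid.self_of_nhds
    rw [hs] at this
    linarith
  filter_upwards [h] with t ht
  rw [ht, hs, hc]
  ring

/-- If a piecewise affine map has a neutral periodic point, then some corner point or
endpoint of `[0,1]` is itself periodic. -/
theorem neutral_orbit_forces_periodic_corner (f : ℝ → ℝ) (hf : IsPLMap f)
    (x : ℝ) (hx : x ∈ Set.Icc 0 1)
    (p : ℕ) (hper : MinimalPeriod f x p)
    (hdiff : DifferentiableWithinAt ℝ (f^[p]) (Set.Icc 0 1) x)
    (hneut : |derivWithin (f^[p]) (Set.Icc 0 1) x| = 1) :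
    ∃ c ∈ cornerSet f ∪ ({0, 1} : Set ℝ), ∃ m : ℕ, 1 ≤ m ∧ f^[m] c = c := by
  obtain ⟨hp, hpx, -⟩ := hper
  by_contra hno
  push Not at hno
  have hmaps (n : ℕ) : Set.MapsTo f^[n] (Set.Icc 0 1) (Set.Icc 0 1) := hf.2.1.iterate n
  have hgood {y : ℝ} (hy : y ∈ Set.Icc (0 : ℝ) 1) {m : ℕ} (hm : 1 ≤ m) (hmy : f^[m] y = y) :
      y ∈ Set.Ioo (0 : ℝ) 1 ∧ EventuallyAffine f y := by
    have hmem : y ∉ cornerSet f ∪ {0, 1} := fun h => hno y h m hm hmy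
    simp only [Set.mem_union, Set.mem_insert_iff, Set.mem_singleton_iff, not_or] at hmem
    have hIoo : y ∈ Set.Ioo (0 : ℝ) 1 :=
      ⟨lt_of_le_of_ne' hy.1 hmem.2.1, lt_of_le_of_ne hy.2 hmem.2.2⟩
    exact ⟨hIoo, hf.eventuallyAffine hIoo hmem.1⟩
  have haff {y : ℝ} (hy : y ∈ Set.Icc (0 : ℝ) 1) {m : ℕ} (hm : 1 ≤ m) (hmy : f^[m] y = y)
      (n : ℕ) : EventuallyAffine f^[n] y :=
    EventuallyAffine.iterate (fun k => (hgood (hmaps k hy) hm (by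
      rw [← Function.iterate_add_apply, add_comm, Function.iterate_add_apply, hmy])).2) n
  have hxI := (hgood hx hp hpx).1
  have hxp := haff hx hp hpx p
  have hcont := hxp.continuousAt
  have hxid : ∀ᶠ t in 𝓝 x, f^[p + p] t = t := by
    obtain ⟨s, c, hsc⟩ := hxp
    rw [derivWithin_of_mem_nhds (Icc_mem_nhds hxI.1 hxI.2),
      ((hasDerivAt_mul_add_const s c x).congr_of_eventuallyEq hsc).deriv] at hneut
    have hss : s * s = 1 := by rw [← abs_mul_abs_self, hneut, one_mul]
    have hfix : s * x + c = x := by rw [← hsc.self_of_nhds, hpx]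
    have hev : ∀ᶠ t in 𝓝 x, f^[p] (f^[p] t) = s * f^[p] t + c :=
      hcont.eventually (by rwa [hpx])
    filter_upwards [hsc, hev] with t h₁ h₂
    rw [Function.iterate_add_apply, h₂, h₁]
    linear_combination (t - x) * hss + (s + 1) * hfix
  have hgcont : ContinuousOn f^[p + p] (Set.Icc 0 1) := hf.1.iterate hf.2.1 _
  set u : Set ℝ := {y | ∀ᶠ t in 𝓝 y, f^[p + p] t = t} ∩ Set.Ioo 0 1
  have hsub : Set.Icc (0 : ℝ) 1 ⊆ u := by
    refine isPreconnected_Icc.subset_of_closure_inter_subset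
      (isOpen_setOfPred_eventually_nhds.inter isOpen_Ioo) ⟨x, hx, hxid, hxI⟩ ?_
    rintro y ⟨hyu, hy⟩
    have huI : u ⊆ Set.Icc 0 1 := fun t ht => Set.Ioo_subset_Icc_self ht.2
    have hyfix : f^[p + p] y = y := by
      have : (𝓝[u] y).NeBot := mem_closure_iff_nhdsWithin_neBot.1 hyu
      have h₁ : Tendsto f^[p + p] (𝓝[u] y) (𝓝 (f^[p + p] y)) := (hgcont y hy).mono huI
      have h₂ : Tendsto f^[p + p] (𝓝[u] y) (𝓝 y) := by
        refine (tendsto_id.mono_left nhdsWithin_le_nhds).congr' ?_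
        filter_upwards [self_mem_nhdsWithin] with t ht
        exact (ht.1.self_of_nhds).symm
      exact tendsto_nhds_unique h₁ h₂
    have hpp : 1 ≤ p + p := by omega
    exact ⟨(haff hy hpp hyfix _).eventually_eq_self hyu fun t ht => ht.1, (hgood hy hpp hyfix).1⟩
  exact lt_irrefl _ (hsub (Set.left_mem_Icc.2 zero_le_one)).2.1
end
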